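/- arXiv:1107.4137 — 4 statements merged into one kernel-verified Lean document; each statement's English description precedes it below -/
import Mathlib

section
/- Let l = 3, a = [1], and let U* be the set of nonnegative integers n with n ≡ 0 (mod 2), n ≡ 1 (mod 4), or n ≡ 3 (mod 8). Then (1) every element n of B(a) lying in U* is the product of a prime and a perfect square; and (2) the number of elements of B(a) that are ≤ x and lie in U* is O(x/log x), i.e. there is a constant C such that for all x ≥ 2 this count is at most C·x/log x. -/
open scoped Classical

/-- The theta series `[i]` for modulus `l`: `∑ x^(n²)` over integers `n ≡ i (mod l)`,
viewed in `ℤ/2[[x]]` (the coefficient of `x^k` is the mod-2 count of such `n` with `n² = k`). -/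
noncomputable def theta (l i : ℤ) : PowerSeries (ZMod 2) :=
  PowerSeries.mk fun k => (({n : ℤ | n ≡ i [ZMOD l] ∧ n ^ 2 = (k : ℤ)}.ncard : ℕ) : ZMod 2)

/-- The theta series viewed in the Laurent series field `L = ℤ/2((x))`. -/
noncomputable def thetaL (l i : ℤ) : LaurentSeries (ZMod 2) := (theta l i : LaurentSeries (ZMod 2))

/-- The projection `p_{q,j}` keeping only the coefficients in degrees `≡ j (mod q)`. -/
noncomputable def proj (q j : ℤ) (f : LaurentSeries (ZMod 2)) : LaurentSeries (ZMod 2) where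
  coeff n := if n ≡ j [ZMOD q] then f.coeff n else 0
  isPWO_support' := f.isPWO_support'.mono (fun n hn => by
    simp only [Function.mem_support, ne_eq] at hn ⊢
    intro h; apply hn; split_ifs <;> simp [h])

/-- `B(g)`: the set of integers `n` such that the coefficient of `x^n` in `1/g` is `1`. -/
noncomputable def Bset (g : PowerSeries (ZMod 2)) : Set ℤ :=
  {n : ℤ | ((g : LaurentSeries (ZMod 2))⁻¹).coeff n = 1}

/-- The subring `S` of `L` generated over `ℤ/2` by `[1], …, [m]`. -/
noncomputable def Sring (l : ℤ) (m : ℕ) : Subring (LaurentSeries (ZMod 2)) :=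
  Subring.closure {x | ∃ i : ℕ, 1 ≤ i ∧ i ≤ m ∧ x = thetaL l i}

/-- The subring `S` of `ℤ/2[[x]]` generated over `ℤ/2` by `[1], …, [m]`. -/
noncomputable def SringPS (l : ℤ) (m : ℕ) : Subring (PowerSeries (ZMod 2)) :=
  Subring.closure {x | ∃ i : ℕ, 1 ≤ i ∧ i ≤ m ∧ x = theta l i}

/-- `U*` for `l = 3`: nonnegative integers `n` with `n ≡ 0 (mod 2)`, `n ≡ 1 (mod 4)`,
or `n ≡ 3 (mod 8)`. -/
def Ustar3 : Set ℤ := {n : ℤ | 0 ≤ n ∧ (n % 2 = 0 ∨ n % 4 = 1 ∨ n % 8 = 3)}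

/-- The integral points of the conic `u² + d v² = N`. -/
def normReps (d N : ℕ) : Set (ℤ × ℤ) := {v | v.1 ^ 2 + d * v.2 ^ 2 = N}

theorem normReps_finite {d : ℕ} (hd : 0 < d) (N : ℕ) : (normReps d N).Finite := by
  apply ((Set.finite_Icc (-(N : ℤ)) N).prod (Set.finite_Icc (-(N : ℤ)) N)).subset
  rintro ⟨u, v⟩ h
  have h' : u ^ 2 + d * v ^ 2 = N := h
  have hd' : (1 : ℤ) ≤ d := by exact_mod_cast hd
  have hu : u ^ 2 ≤ N := by nlinarith [sq_nonneg v]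
  have hv : v ^ 2 ≤ N := by nlinarith [sq_nonneg v, sq_nonneg u]
  refine ⟨⟨?_, ?_⟩, ?_, ?_⟩ <;> simp only <;> nlinarith

/-- Multiplication by `x + y√-d` on pairs representing elements of `ℤ[√-d]`. -/
def mulPair (d : ℕ) (x y : ℤ) (v : ℤ × ℤ) : ℤ × ℤ := (v.1 * x - d * v.2 * y, v.1 * y + v.2 * x)

theorem mulPair_norm (d : ℕ) (x y : ℤ) (v : ℤ × ℤ) :
    (mulPair d x y v).1 ^ 2 + d * (mulPair d x y v).2 ^ 2 =
      (x ^ 2 + d * y ^ 2) * (v.1 ^ 2 + d * v.2 ^ 2) := by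
  simp only [mulPair]; ring

theorem mulPair_injective {d : ℕ} {x y : ℤ} (h : x ^ 2 + d * y ^ 2 ≠ 0) :
    Function.Injective (mulPair d x y) := by
  rintro ⟨a, b⟩ ⟨a', b'⟩ hab
  simp only [mulPair, Prod.mk.injEq] at hab
  obtain ⟨h1, h2⟩ := hab
  ext
  · apply mul_right_cancel₀ h
    linear_combination x * h1 + d * y * h2
  · apply mul_right_cancel₀ h
    linear_combination x * h2 - y * h1

/-- A pair whose product with the conjugate of `x + y√-d` is divisible by `p = x² + d y²`
is a multiple of `x + y√-d`. -/
theorem mem_image_mulPair {d p M : ℕ} {x y : ℤ} (hp : 0 < p) (hxy : x ^ 2 + d * y ^ 2 = p)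
    {v : ℤ × ℤ} (hv : v ∈ normReps d (p * M)) (h1 : (p : ℤ) ∣ v.1 * x + d * v.2 * y)
    (h2 : (p : ℤ) ∣ v.2 * x - v.1 * y) : v ∈ mulPair d x y '' normReps d M := by
  obtain ⟨u, w⟩ := v
  obtain ⟨a, ha⟩ := h1
  obtain ⟨b, hb⟩ := h2
  have hp0 : (p : ℤ) ≠ 0 := by exact_mod_cast hp.ne'
  have hv' : u ^ 2 + d * w ^ 2 = p * M := by simpa [normReps] using hv
  simp only at ha hb
  have e1 : u = a * x - d * b * y := by
    apply mul_left_cancel₀ hp0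
    linear_combination x * ha - d * y * hb - u * hxy
  have e2 : w = a * y + b * x := by
    apply mul_left_cancel₀ hp0
    linear_combination y * ha + x * hb - w * hxy
  refine ⟨(a, b), ?_, by simp [mulPair, e1, e2]⟩
  change a ^ 2 + d * b ^ 2 = M
  apply mul_left_cancel₀ hp0
  rw [← hv', ← hxy, e1, e2]
  ring

theorem image_mulPair_subset {d p M : ℕ} {x y : ℤ} (hxy : x ^ 2 + d * y ^ 2 = p) :
    mulPair d x y '' normReps d M ⊆ normReps d (p * M) := by
  rintro _ ⟨v, hv, rfl⟩
  have hv' : v.1 ^ 2 + d * v.2 ^ 2 = M := hv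
  change (mulPair d x y v).1 ^ 2 + d * (mulPair d x y v).2 ^ 2 = ((p * M : ℕ) : ℤ)
  rw [mulPair_norm, hxy, hv']
  push_cast; rfl

/-- Elements of norm divisible by a split prime are divisible by one of its two factors. -/
theorem normReps_mul_eq_union {d p M : ℕ} {x y : ℤ} (hp : p.Prime)
    (hxy : x ^ 2 + d * y ^ 2 = p) :
    normReps d (p * M) = mulPair d x y '' normReps d M ∪ mulPair d x (-y) '' normReps d M := by
  have hxy' : x ^ 2 + d * (-y) ^ 2 = p := by rw [← hxy]; ring
  apply Set.Subset.antisymm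
  · rintro ⟨u, w⟩ h
    have h' : u ^ 2 + d * w ^ 2 = p * M := by simpa [normReps] using h
    have hpp : Prime (p : ℤ) := Nat.prime_iff_prime_int.mp hp
    have key : (p : ℤ) ∣ (w * x - u * y) * (w * x + u * y) :=
      ⟨w ^ 2 - y ^ 2 * M, by linear_combination w ^ 2 * hxy - y ^ 2 * h'⟩
    have aux : ∀ z : ℤ, x ^ 2 + d * z ^ 2 = p → (p : ℤ) ∣ w * x - u * z →
        (p : ℤ) ∣ u * x + d * w * z := by
      rintro z hz ⟨c, hc⟩
      apply hpp.dvd_of_dvd_pow (n := 2)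
      refine ⟨p * M - d * p * c ^ 2, ?_⟩
      linear_combination (u ^ 2 + d * w ^ 2) * hz + p * h' - d * (w * x - u * z + p * c) * hc
    rcases hpp.dvd_or_dvd key with h1 | h1
    · exact Or.inl (mem_image_mulPair hp.pos hxy h (aux y hxy h1) h1)
    · have h1' : (p : ℤ) ∣ w * x - u * (-y) := by simpa using h1
      exact Or.inr (mem_image_mulPair hp.pos hxy' h (aux (-y) hxy' h1') h1')
  · exact Set.union_subset (image_mulPair_subset hxy) (image_mulPair_subset hxy')

theorem dvd_of_mem_inter {d p M : ℕ} {x y : ℤ} (hp : p.Prime) (hpd : ¬ p ∣ 2 * d)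
    (hxy : x ^ 2 + d * y ^ 2 = p) {v : ℤ × ℤ}
    (h1 : v ∈ mulPair d x y '' normReps d M) (h2 : v ∈ mulPair d x (-y) '' normReps d M) :
    (p : ℤ) ∣ v.1 ∧ (p : ℤ) ∣ v.2 := by
  have hpp : Prime (p : ℤ) := Nat.prime_iff_prime_int.mp hp
  obtain ⟨⟨a, b⟩, -, rfl⟩ := h1
  obtain ⟨⟨a', b'⟩, -, h⟩ := h2
  simp only [mulPair, Prod.mk.injEq] at h ⊢
  obtain ⟨e1, e2⟩ := h
  have h2 : ¬ (p : ℤ) ∣ 2 := fun h => hpd (by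
    have : p ∣ 2 := by exact_mod_cast h
    exact this.mul_right d)
  have hd : ¬ (p : ℤ) ∣ d := fun h => hpd ((Int.natCast_dvd_natCast.mp h).mul_left 2)
  have hx : ¬ (p : ℤ) ∣ x := by
    rintro ⟨c, rfl⟩
    have h3 : (p : ℤ) ∣ d * y ^ 2 := ⟨1 - p * c ^ 2, by linear_combination hxy⟩
    obtain ⟨c', rfl⟩ := hpp.dvd_of_dvd_pow ((hpp.dvd_or_dvd h3).resolve_left hd)
    have h4 : (p : ℤ) * (p * (c ^ 2 + d * c' ^ 2)) = p * 1 := by linear_combination hxy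
    exact hpp.not_isUnit (isUnit_of_dvd_one ⟨_, (mul_left_cancel₀ hpp.ne_zero h4).symm⟩)
  have cancel : ∀ z : ℤ, (p : ℤ) ∣ 2 * x * z → (p : ℤ) ∣ z := fun z hz =>
    (hpp.dvd_or_dvd hz).resolve_left fun h => (hpp.dvd_or_dvd h).elim h2 hx
  constructor
  · exact cancel _ ⟨a + a', by linear_combination (a + a') * hxy - x * e1 + d * y * e2⟩
  · exact cancel _ ⟨b + b', by linear_combination (b + b') * hxy - y * e1 - x * e2⟩

theorem ncard_image_smul {d p M : ℕ} (hp : p ≠ 0) :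
    ((fun v : ℤ × ℤ => ((p : ℤ) * v.1, (p : ℤ) * v.2)) '' normReps d M).ncard =
      (normReps d M).ncard := by
  apply Set.ncard_image_of_injective
  rintro ⟨a, b⟩ ⟨a', b'⟩ h
  simpa [hp] using h

/-- The imprimitive elements of norm `p² M`. -/
theorem setOf_dvd_normReps {d p M : ℕ} (hp : p ≠ 0) :
    {v | v ∈ normReps d (p * (p * M)) ∧ (p : ℤ) ∣ v.1 ∧ (p : ℤ) ∣ v.2} =
      (fun v : ℤ × ℤ => ((p : ℤ) * v.1, (p : ℤ) * v.2)) '' normReps d M := by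
  have hp0 : (p : ℤ) ≠ 0 := by exact_mod_cast hp
  ext ⟨u, w⟩
  simp only [normReps, Set.mem_ofPred_eq, Set.mem_image, Prod.exists, Prod.mk.injEq]
  push_cast
  constructor
  · rintro ⟨h, ⟨a, rfl⟩, b, rfl⟩
    refine ⟨a, b, ?_, rfl, rfl⟩
    apply mul_left_cancel₀ (mul_ne_zero hp0 hp0)
    linear_combination h
  · rintro ⟨a, b, h, rfl, rfl⟩
    exact ⟨by linear_combination p ^ 2 * h, dvd_mul_right _ _, dvd_mul_right _ _⟩

theorem ncard_add_ncard_inter {d p M : ℕ} {x y : ℤ} (hd : 0 < d) (hp : p.Prime)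
    (hxy : x ^ 2 + d * y ^ 2 = p) :
    (normReps d (p * M)).ncard +
      (mulPair d x y '' normReps d M ∩ mulPair d x (-y) '' normReps d M).ncard =
      2 * (normReps d M).ncard := by
  have hp0 : (p : ℤ) ≠ 0 := by exact_mod_cast hp.ne_zero
  rw [normReps_mul_eq_union hp hxy, Set.ncard_union_add_ncard_inter _ _
    ((normReps_finite hd M).image _) ((normReps_finite hd M).image _),
    Set.ncard_image_of_injective _ (mulPair_injective (by rwa [hxy])),
    Set.ncard_image_of_injective _ (mulPair_injective (by rwa [neg_sq, hxy]))]
  ring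

theorem ncard_normReps_mul {d p M : ℕ} {x y : ℤ} (hd : 0 < d) (hp : p.Prime)
    (hpd : ¬ p ∣ 2 * d) (hxy : x ^ 2 + d * y ^ 2 = p) (hM : ¬ p ∣ M) :
    (normReps d (p * M)).ncard = 2 * (normReps d M).ncard := by
  rw [← ncard_add_ncard_inter (M := M) hd hp hxy, left_eq_add, Set.ncard_eq_zero
    (((normReps_finite hd M).image _).inter_of_left _), Set.eq_empty_iff_forall_notMem]
  rintro v ⟨h1, h2⟩
  obtain ⟨⟨a, ha⟩, b, hb⟩ := dvd_of_mem_inter hp hpd hxy h1 h2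
  have hv := image_mulPair_subset hxy h1
  have hv' : v.1 ^ 2 + d * v.2 ^ 2 = p * M := by simpa [normReps] using hv
  have hp0 : (p : ℤ) ≠ 0 := by exact_mod_cast hp.ne_zero
  apply hM
  rw [← Int.natCast_dvd_natCast]
  refine ⟨a ^ 2 + d * b ^ 2, ?_⟩
  apply mul_left_cancel₀ hp0
  rw [← hv', ha, hb]; ring

theorem ncard_normReps_mul_mul {d p M : ℕ} {x y : ℤ} (hd : 0 < d) (hp : p.Prime)
    (hpd : ¬ p ∣ 2 * d) (hxy : x ^ 2 + d * y ^ 2 = p) :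
    (normReps d (p * (p * M))).ncard + (normReps d M).ncard =
      2 * (normReps d (p * M)).ncard := by
  have hp0 : (p : ℤ) ≠ 0 := by exact_mod_cast hp.ne_zero
  rw [← ncard_add_ncard_inter (M := p * M) hd hp hxy, add_right_inj,
    ← ncard_image_smul (M := M) hp.ne_zero, ← setOf_dvd_normReps hp.ne_zero]
  congr 1
  apply Set.Subset.antisymm
  · rintro v ⟨hv, h1, h2⟩
    have aux : ∀ z : ℤ, x ^ 2 + d * z ^ 2 = p →
        v ∈ mulPair d x z '' normReps d (p * M) := fun z hz =>
      mem_image_mulPair hp.pos hz hv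
        (dvd_add (h1.mul_right x) ((h2.mul_left d).mul_right z))
        (dvd_sub (h2.mul_right x) (h1.mul_right z))
    exact ⟨aux y hxy, aux (-y) (by rw [neg_sq, hxy])⟩
  · rintro v ⟨h1, h2⟩
    exact ⟨image_mulPair_subset hxy h1, dvd_of_mem_inter hp hpd hxy h1 h2⟩

/-- Elements of norm `p^e M`, for a split prime `p` not dividing `M`. -/
theorem ncard_normReps_pow_mul {d p M : ℕ} {x y : ℤ} (hd : 0 < d) (hp : p.Prime)
    (hpd : ¬ p ∣ 2 * d) (hxy : x ^ 2 + d * y ^ 2 = p) (hM : ¬ p ∣ M) (e : ℕ) :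
    (normReps d (p ^ e * M)).ncard = (e + 1) * (normReps d M).ncard := by
  induction e using Nat.twoStepInduction with
  | zero => simp
  | one => simpa using ncard_normReps_mul hd hp hpd hxy hM
  | more e ih1 ih2 =>
    have h := ncard_normReps_mul_mul (M := p ^ e * M) hd hp hpd hxy
    rw [ih1, show p * (p ^ e * M) = p ^ (e + 1) * M by ring, ih2,
      show p * (p ^ (e + 1) * M) = p ^ (e + 2) * M by ring] at h
    linarith

theorem ncard_normReps_pow_mul_of_inert {d p M : ℕ} (hp : p.Prime)
    (hin : ∀ u v : ℤ, (p : ℤ) ∣ u ^ 2 + d * v ^ 2 → (p : ℤ) ∣ u ∧ (p : ℤ) ∣ v)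
    (hM : ¬ p ∣ M) (j : ℕ) : (normReps d (p ^ (2 * j + 1) * M)).ncard = 0 := by
  have hp0 : (p : ℤ) ≠ 0 := by exact_mod_cast hp.ne_zero
  induction j with
  | zero =>
    convert Set.ncard_empty (ℤ × ℤ)
    rw [Set.eq_empty_iff_forall_notMem]
    rintro ⟨u, v⟩ h
    have h' : u ^ 2 + d * v ^ 2 = p * M := by simpa [normReps] using h
    obtain ⟨⟨a, rfl⟩, b, rfl⟩ := hin u v ⟨M, h'⟩
    apply hM
    rw [← Int.natCast_dvd_natCast]
    refine ⟨a ^ 2 + d * b ^ 2, ?_⟩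
    apply mul_left_cancel₀ hp0
    rw [← h']; ring
  | succ j ih =>
    rw [← ih, ← ncard_image_smul (M := p ^ (2 * j + 1) * M) hp.ne_zero,
      ← setOf_dvd_normReps hp.ne_zero,
      show p ^ (2 * (j + 1) + 1) * M = p * (p * (p ^ (2 * j + 1) * M)) by ring]
    congr 1
    ext v
    refine ⟨fun hv => ⟨hv, hin _ _ ?_⟩, fun hv => hv.1⟩
    have hv' : v.1 ^ 2 + d * v.2 ^ 2 = ((p * (p * (p ^ (2 * j + 1) * M)) : ℕ) : ℤ) := hv
    rw [hv']
    push_cast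
    exact dvd_mul_right _ _

/-- Thue's lemma. -/
theorem exists_sq_lt_dvd_sub_mul {p : ℕ} (hp : p.Prime) (t : ℤ) :
    ∃ x y : ℤ, (x ≠ 0 ∨ y ≠ 0) ∧ x ^ 2 < p ∧ y ^ 2 < p ∧ (p : ℤ) ∣ x - t * y := by
  have hsq : p.sqrt ^ 2 < p := by
    rcases (Nat.sqrt_le' p).lt_or_eq with h | h
    · exact h
    · exact absurd (h ▸ hp) (Nat.Prime.not_prime_pow le_rfl)
  have : NeZero p := ⟨hp.ne_zero⟩
  let S := Finset.range (p.sqrt + 1) ×ˢ Finset.range (p.sqrt + 1)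
  obtain ⟨⟨a, b⟩, hab, ⟨a', b'⟩, hab', hne, heq⟩ :=
    Finset.exists_ne_map_eq_of_card_lt_of_maps_to (s := S) (t := Finset.univ)
      (f := fun v : ℕ × ℕ => ((v.1 - t * v.2 : ℤ) : ZMod p))
      (by
        rw [Finset.card_univ, ZMod.card, Finset.card_product, Finset.card_range]
        exact Nat.lt_succ_sqrt p) (fun _ _ => Finset.mem_coe.mpr (Finset.mem_univ _))
  simp only [S, Finset.mem_product, Finset.mem_range, Nat.lt_succ_iff] at hab hab'
  have bound : ∀ m n : ℕ, m ≤ p.sqrt → n ≤ p.sqrt → ((m : ℤ) - n) ^ 2 < p := by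
    intro m n hm hn
    have h1 : ((m : ℤ) - n) ^ 2 ≤ (p.sqrt : ℤ) ^ 2 := by
      apply sq_le_sq'  <;> omega
    have h2 : (p.sqrt : ℤ) ^ 2 < p := by exact_mod_cast hsq
    linarith
  refine ⟨a - a', b - b', ?_, bound _ _ hab.1 hab'.1, bound _ _ hab.2 hab'.2, ?_⟩
  · by_contra! h
    apply hne
    ext <;> simp only <;> omega
  · have h := (ZMod.intCast_eq_intCast_iff_dvd_sub _ _ _).mp heq
    obtain ⟨c, hc⟩ := h
    simp only at hc
    exact ⟨-c, by linear_combination -hc⟩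

/-- For `d ∈ {1, 2}` an odd prime is either of the form `x² + d y²` or inert. -/
theorem split_or_inert {d p : ℕ} (hd : d = 1 ∨ d = 2) (hp : p.Prime) :
    (∃ x y : ℤ, x ^ 2 + d * y ^ 2 = p) ∨
      ∀ u v : ℤ, (p : ℤ) ∣ u ^ 2 + d * v ^ 2 → (p : ℤ) ∣ u ∧ (p : ℤ) ∣ v := by
  rw [or_iff_not_imp_right]
  intro h
  push Not at h
  obtain ⟨u, v, huv, hnot⟩ := h
  have hpp : Prime (p : ℤ) := Nat.prime_iff_prime_int.mp hp
  have hv : ¬ (p : ℤ) ∣ v := fun hv => by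
    refine hnot (hpp.dvd_of_dvd_pow (n := 2) ?_) hv
    have h1 : (p : ℤ) ∣ d * v ^ 2 := (hv.pow two_ne_zero).mul_left _
    exact (dvd_add_left h1).mp huv
  obtain ⟨s, c, hsc⟩ : IsCoprime v p := ((Prime.coprime_iff_not_dvd hpp).mpr hv).symm
  obtain ⟨x, y, hne, hx, hy, k, hk⟩ := exists_sq_lt_dvd_sub_mul hp (u * s)
  have hdvd : (p : ℤ) ∣ x ^ 2 + d * y ^ 2 := by
    obtain ⟨w, hw⟩ := huv
    refine ⟨k * (x + u * s * y) + y ^ 2 * (s ^ 2 * w + d * c * (1 + s * v)), ?_⟩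
    linear_combination (x + u * s * y) * hk + s ^ 2 * y ^ 2 * hw - d * y ^ 2 * (1 + s * v) * hsc
  obtain ⟨q, hq⟩ := hdvd
  have hp0 : (0 : ℤ) < p := by exact_mod_cast hp.pos
  have hpos : 0 < x ^ 2 + d * y ^ 2 := by
    have hd1 : (1 : ℤ) ≤ d := by rcases hd with rfl | rfl <;> norm_num
    rcases hne with h | h
    · have := pow_pos (abs_pos.mpr h) 2
      rw [sq_abs] at this
      nlinarith [sq_nonneg y]
    · have := pow_pos (abs_pos.mpr h) 2
      rw [sq_abs] at this
      nlinarith [sq_nonneg x]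
  have hq0 : 0 < q := by
    rw [hq] at hpos
    exact pos_of_mul_pos_right hpos hp0.le
  rcases hd with rfl | rfl
  · have : q < 2 := by
      by_contra! h
      push_cast at hq
      nlinarith
    obtain rfl : q = 1 := by omega
    exact ⟨x, y, by rw [hq, mul_one]⟩
  · have : q < 3 := by
      by_contra! h
      push_cast at hq
      nlinarith
    obtain rfl | rfl : q = 1 ∨ q = 2 := by omega
    · exact ⟨x, y, by rw [hq, mul_one]⟩
    · have h2 : (2 : ℤ) ∣ x := by
        apply Int.prime_two.dvd_of_dvd_pow (n := 2)
        refine ⟨p - y ^ 2, ?_⟩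
        push_cast at hq
        linarith
      obtain ⟨z, rfl⟩ := h2
      refine ⟨y, z, ?_⟩
      push_cast at hq ⊢
      linarith

theorem two_mul_ncard_dvd {d p M e : ℕ} (hd : d = 1 ∨ d = 2) (hp : p.Prime) (hp2 : p ≠ 2)
    (hM : ¬ p ∣ M) (he : Odd e) :
    2 * (normReps d M).ncard ∣ (normReps d (p ^ e * M)).ncard := by
  obtain ⟨j, rfl⟩ := he
  rcases split_or_inert hd hp with ⟨x, y, hxy⟩ | hin
  · have hpd : ¬ p ∣ 2 * d := by
      have h2 : ¬ p ∣ 2 := fun h => hp2 ((Nat.prime_dvd_prime_iff_eq hp Nat.prime_two).mp h)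
      rcases hd with rfl | rfl
      · simpa using h2
      · rw [hp.dvd_mul]; simpa using h2
    rw [ncard_normReps_pow_mul (by omega) hp hpd hxy hM]
    exact ⟨j + 1, by ring⟩
  · rw [ncard_normReps_pow_mul_of_inert hp hin hM]
    exact dvd_zero _

theorem ncard_signed {P : Set (ℕ × ℕ)} (hP : ∀ v ∈ P, 0 < v.1 ∧ 0 < v.2) {c e : ℕ}
    (hc : 0 < c) (he : 0 < e) :
    {w : ℤ × ℤ | ∃ v ∈ P, w.1.natAbs = c * v.1 ∧ w.2.natAbs = e * v.2}.ncard = 4 * P.ncard := by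
  have key : {w : ℤ × ℤ | ∃ v ∈ P, w.1.natAbs = c * v.1 ∧ w.2.natAbs = e * v.2} =
      (fun q : (ℕ × ℕ) × (ℤˣ × ℤˣ) =>
        ((q.2.1 : ℤ) * (c * q.1.1 : ℕ), (q.2.2 : ℤ) * (e * q.1.2 : ℕ))) '' (P ×ˢ Set.univ) := by
    ext ⟨u, w⟩
    constructor
    · rintro ⟨v, hv, h1, h2⟩
      have sgn : ∀ (z : ℤ) (n : ℕ), z.natAbs = n → ∃ s : ℤˣ, (s : ℤ) * n = z := by
        intro z n h
        rcases Int.natAbs_eq z with h' | h'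
        · exact ⟨1, by rw [h', h]; simp⟩
        · exact ⟨-1, by rw [h', h]; simp⟩
      obtain ⟨s, hs⟩ := sgn u _ h1
      obtain ⟨t, ht⟩ := sgn w _ h2
      exact ⟨(v, (s, t)), ⟨hv, Set.mem_univ _⟩, Prod.ext hs ht⟩
    · rintro ⟨⟨v, s, t⟩, ⟨hv, -⟩, h⟩
      simp only [Prod.mk.injEq] at h
      refine ⟨v, hv, ?_, ?_⟩
      · simp only [← h.1, Int.natAbs_mul, Int.units_natAbs, Int.natAbs_natCast, one_mul]
      · simp only [← h.2, Int.natAbs_mul, Int.units_natAbs, Int.natAbs_natCast, one_mul]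
  rw [key, Set.InjOn.ncard_image, Set.ncard_prod, Set.ncard_univ, Nat.card_eq_fintype_card,
    Fintype.card_prod, Fintype.card_units_int]
  · ring
  · have inj : ∀ (s s' : ℤˣ) (n n' : ℕ), 0 < n → (s : ℤ) * n = s' * n' → s = s' ∧ n = n' := by
      intro s s' n n' hn h
      have h1 : n = n' := by
        have := congrArg Int.natAbs h
        simpa [Int.natAbs_mul] using this
      subst h1
      refine ⟨Units.ext ?_, rfl⟩
      exact mul_right_cancel₀ (by exact_mod_cast hn.ne') h
    rintro ⟨⟨a, b⟩, s, t⟩ ⟨hab, -⟩ ⟨⟨a', b'⟩, s', t'⟩ - h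
    simp only [Prod.mk.injEq] at h
    obtain ⟨ha, hb⟩ := hP _ hab
    obtain ⟨rfl, h1⟩ := inj _ _ _ _ (Nat.mul_pos hc ha) h.1
    obtain ⟨rfl, h2⟩ := inj _ _ _ _ (Nat.mul_pos he hb) h.2
    obtain rfl : a = a' := Nat.eq_of_mul_eq_mul_left hc h1
    obtain rfl : b = b' := Nat.eq_of_mul_eq_mul_left he h2
    rfl

theorem even_ncard_normReps {d M : ℕ} (hd : 0 < d) (hM : 0 < M) :
    Even (normReps d M).ncard := by
  rw [Set.ncard_eq_toFinset_card _ (normReps_finite hd M), ← ZMod.natCast_eq_zero_iff_even,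
    Finset.card_eq_sum_ones, Nat.cast_sum]
  refine Finset.sum_involution (fun v _ => -v) (fun _ _ => by decide) ?_ ?_ (fun _ _ => neg_neg _)
  · rintro ⟨u, w⟩ hv - h
    rw [Set.Finite.mem_toFinset] at hv
    have hv' : u ^ 2 + d * w ^ 2 = M := hv
    simp only [Prod.neg_mk, Prod.mk.injEq] at h
    obtain ⟨rfl, rfl⟩ : u = 0 ∧ w = 0 := by omega
    simp at hv'
    omega
  · intro v hv
    rw [Set.Finite.mem_toFinset] at hv ⊢
    simpa [normReps] using hv

theorem sq_mod_three {r : ℕ} (h : ¬ 3 ∣ r) : r ^ 2 % 3 = 1 := by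
  have : r % 3 = 1 ∨ r % 3 = 2 := by omega
  rcases this with h | h <;> simp [Nat.pow_mod, h]

theorem not_isSquare_of_mod_three {n : ℕ} (h : n % 3 = 2) : ¬ IsSquare n := by
  rintro ⟨z, rfl⟩
  have : z % 3 = 0 ∨ z % 3 = 1 ∨ z % 3 = 2 := by omega
  rcases this with h' | h' | h' <;> simp [Nat.mul_mod, h'] at h

theorem sq_mod_eight {r : ℕ} (h : Odd r) : r ^ 2 % 8 = 1 := by
  have : r % 8 = 1 ∨ r % 8 = 3 ∨ r % 8 = 5 ∨ r % 8 = 7 := by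
    have := Nat.odd_iff.mp h; omega
  rcases this with h | h | h | h <;> simp [Nat.pow_mod, h]

theorem int_sq_mod_three (u : ℤ) : (3 : ℤ) ∣ u ∧ u ^ 2 % 3 = 0 ∨ ¬ (3 : ℤ) ∣ u ∧ u ^ 2 % 3 = 1 := by
  have : u % 3 = 0 ∨ u % 3 = 1 ∨ u % 3 = 2 := by omega
  rcases this with h | h | h
  · exact Or.inl ⟨Int.dvd_of_emod_eq_zero h, by simp [pow_two, Int.mul_emod, h]⟩
  · exact Or.inr ⟨by omega, by simp [pow_two, Int.mul_emod, h]⟩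
  · exact Or.inr ⟨by omega, by simp [pow_two, Int.mul_emod, h]⟩

theorem int_sq_mod_eight (u : ℤ) :
    Odd u ∧ u ^ 2 % 8 = 1 ∨ Even u ∧ (u ^ 2 % 8 = 0 ∨ u ^ 2 % 8 = 4) := by
  have : u % 8 = 0 ∨ u % 8 = 1 ∨ u % 8 = 2 ∨ u % 8 = 3 ∨ u % 8 = 4 ∨ u % 8 = 5 ∨ u % 8 = 6 ∨
    u % 8 = 7 := by omega
  rw [Int.odd_iff, Int.even_iff]
  rcases this with h | h | h | h | h | h | h | h <;>
    simp [pow_two, Int.mul_emod, h] <;> omega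

theorem ncard_normReps_one {n : ℕ} (hn : Odd n) :
    (normReps 1 n).ncard = 2 * (normReps 4 n).ncard := by
  let f : ℤ × ℤ → ℤ × ℤ := fun v => (v.1, 2 * v.2)
  let g : ℤ × ℤ → ℤ × ℤ := fun v => (2 * v.2, v.1)
  have hf : Function.Injective f := by
    rintro ⟨a, b⟩ ⟨a', b'⟩ h
    simpa [f] using h
  have hg : Function.Injective g := by
    rintro ⟨a, b⟩ ⟨a', b'⟩ h
    simpa [g, and_comm] using h
  have hodd : ∀ v ∈ normReps 4 n, Odd v.1 := by
    rintro ⟨u, w⟩ h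
    have h' : u ^ 2 + (4 : ℕ) * w ^ 2 = n := h
    rw [Nat.odd_iff] at hn
    push_cast at h'
    rcases int_sq_mod_eight u with h2 | h2
    · exact h2.1
    · omega
  have key : normReps 1 n = f '' normReps 4 n ∪ g '' normReps 4 n := by
    ext ⟨u, w⟩
    constructor
    · intro h
      have h' : u ^ 2 + (1 : ℕ) * w ^ 2 = n := h
      rcases Int.even_or_odd w with hw | hw
      · obtain ⟨t, rfl⟩ := hw.two_dvd
        refine Or.inl ⟨(u, t), ?_, rfl⟩
        change u ^ 2 + (4 : ℕ) * t ^ 2 = n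
        rw [← h']; push_cast; ring
      · have hu : Even u := by
          rw [Nat.odd_iff] at hn
          rw [Int.odd_iff] at hw
          have h2 := int_sq_mod_eight u
          have h3 := int_sq_mod_eight w
          rw [Int.odd_iff, Int.even_iff] at h2 h3
          rw [Int.even_iff]
          push_cast at h'
          omega
        obtain ⟨t, rfl⟩ := hu.two_dvd
        refine Or.inr ⟨(w, t), ?_, rfl⟩
        change w ^ 2 + (4 : ℕ) * t ^ 2 = n
        rw [← h']; push_cast; ring
    · rintro (⟨⟨a, b⟩, h, h1⟩ | ⟨⟨a, b⟩, h, h1⟩) <;>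
      · have h' : a ^ 2 + (4 : ℕ) * b ^ 2 = n := h
        rw [← h1]
        simp only [normReps, Set.mem_ofPred_eq, f, g, ← h']
        push_cast; ring
  rw [key, Set.ncard_union_eq _ ((normReps_finite (by norm_num) n).image _)
    ((normReps_finite (by norm_num) n).image _), Set.ncard_image_of_injective _ hf,
    Set.ncard_image_of_injective _ hg]
  · ring
  · rw [Set.disjoint_left]
    rintro _ ⟨v, hv, rfl⟩ ⟨w, -, h⟩
    have h1 : 2 * w.2 = v.1 := congrArg Prod.fst h
    have := hodd v hv
    rw [← h1, Int.odd_iff] at this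
    omega

/-- If a nonsquare `n` is not a prime times a square, then two distinct primes divide `n` to an
odd power. -/
theorem exists_two_odd_primes {n : ℕ} (hn : n ≠ 0) (hsq : ¬ IsSquare n)
    (hpk : ¬ ∃ p k : ℕ, p.Prime ∧ n = p * k ^ 2) :
    ∃ p q e f M : ℕ, p.Prime ∧ q.Prime ∧ Odd e ∧ Odd f ∧ M ≠ 0 ∧ ¬ p ∣ q ^ f * M ∧ ¬ q ∣ M ∧
      n = p ^ e * (q ^ f * M) := by
  have step : ∀ n : ℕ, n ≠ 0 → ¬ IsSquare n → ∃ p e M : ℕ, p.Prime ∧ Odd e ∧ M ≠ 0 ∧ ¬ p ∣ M ∧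
      n = p ^ e * M := by
    intro n hn hsq
    obtain ⟨s, b, hb, hs⟩ := Nat.sq_mul_squarefree n
    have hs1 : s ≠ 1 := by
      rintro rfl
      exact hsq ⟨b, by rw [← hb]; ring⟩
    obtain ⟨p, hp, t, rfl⟩ := Nat.exists_prime_and_dvd hs1
    have hb0 : b ≠ 0 := by rintro rfl; simp at hb; omega
    obtain ⟨j, c, hc, rfl⟩ := Nat.exists_eq_pow_mul_and_not_dvd hb0 p hp.ne_one
    have ht : ¬ p ∣ t := fun ⟨w, hw⟩ => hp.not_isUnit (hs p ⟨w, by rw [hw]; ring⟩)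
    have hM : ¬ p ∣ c ^ 2 * t := fun h => (hp.dvd_mul.mp h).elim
      (fun h => hc (hp.dvd_of_dvd_pow h)) ht
    refine ⟨p, 2 * j + 1, c ^ 2 * t, hp, ⟨j, rfl⟩, ?_, hM, by rw [← hb]; ring⟩
    intro h; exact hM (h ▸ dvd_zero p)
  obtain ⟨p, e, M, hp, he, hM0, hpM, rfl⟩ := step n hn hsq
  have hMsq : ¬ IsSquare M := by
    rintro ⟨z, rfl⟩
    obtain ⟨j, rfl⟩ := he
    exact hpk ⟨p, p ^ j * z, hp, by ring⟩
  obtain ⟨q, f, M', hq, hf, hM0', hqM, rfl⟩ := step M hM0 hMsq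
  exact ⟨p, q, e, f, M', hp, hq, he, hf, hM0', hpM, hqM, rfl⟩

theorem four_mul_ncard_dvd {d n : ℕ} (hd : d = 1 ∨ d = 2) (hn : Odd n) (hsq : ¬ IsSquare n)
    (hpk : ¬ ∃ p k : ℕ, p.Prime ∧ n = p * k ^ 2) :
    ∃ M, Odd M ∧ 4 * (normReps d M).ncard ∣ (normReps d n).ncard := by
  obtain ⟨p, q, e, f, M, hp, hq, he, hf, hM0, hpM, hqM, rfl⟩ :=
    exists_two_odd_primes hn.pos.ne' hsq hpk
  rw [Nat.odd_mul, Nat.odd_mul, Nat.odd_pow_iff he.pos.ne', Nat.odd_pow_iff hf.pos.ne'] at hn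
  obtain ⟨hp2, hq2, hM⟩ := hn
  refine ⟨M, hM, ?_⟩
  have h1 := two_mul_ncard_dvd hd hp (by rintro rfl; exact absurd hp2 (by decide)) hpM he
  have h2 := two_mul_ncard_dvd hd hq (by rintro rfl; exact absurd hq2 (by decide)) hqM hf
  exact (by
    rw [show 4 * (normReps d M).ncard = 2 * (2 * (normReps d M).ncard) by ring]
    exact (Nat.mul_dvd_mul_left 2 h2).trans h1)

/-- Odd integers with an odd number of representations `r² + 4 t²`, `3 ∤ r t`. -/
theorem prime_mul_sq_of_odd_ncard_one_four {n : ℕ}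
    (h : Odd {v : ℕ × ℕ | (Odd v.1 ∧ ¬ 3 ∣ v.1) ∧ ¬ 3 ∣ v.2 ∧ 1 * v.1 ^ 2 + 4 * v.2 ^ 2 = n}.ncard) :
    ∃ p k : ℕ, p.Prime ∧ n = p * k ^ 2 := by
  set P := {v : ℕ × ℕ | (Odd v.1 ∧ ¬ 3 ∣ v.1) ∧ ¬ 3 ∣ v.2 ∧ 1 * v.1 ^ 2 + 4 * v.2 ^ 2 = n} with hP
  obtain ⟨⟨r, t⟩, ⟨hr, hr3⟩, ht3, hrt⟩ := Set.nonempty_of_ncard_ne_zero h.pos.ne'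
  simp only at hr hr3 ht3 hrt
  have hn3 : n % 3 = 2 := by
    have := sq_mod_three hr3; have := sq_mod_three ht3; omega
  have hn : Odd n := by
    have := sq_mod_eight hr
    rw [Nat.odd_iff]; omega
  by_contra hpk
  obtain ⟨M, hM, hdvd⟩ := four_mul_ncard_dvd (Or.inl rfl) hn (not_isSquare_of_mod_three hn3) hpk
  have hset : normReps 4 n =
      {w : ℤ × ℤ | ∃ v ∈ P, w.1.natAbs = 1 * v.1 ∧ w.2.natAbs = 1 * v.2} := by
    ext ⟨u, w⟩
    simp only [normReps, Set.mem_ofPred_eq, one_mul, Prod.exists]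
    constructor
    · intro h
      refine ⟨u.natAbs, w.natAbs, ⟨⟨?_, ?_⟩, ?_, ?_⟩, rfl, rfl⟩
      · rw [Int.natAbs_odd]
        have := int_sq_mod_eight u
        rw [Nat.odd_iff] at hn
        push_cast at h
        rcases this with h' | h'
        · exact h'.1
        · omega
      · rw [← Int.natCast_dvd]
        have := int_sq_mod_three u; have := int_sq_mod_three w
        push_cast at h ⊢
        omega
      · rw [← Int.natCast_dvd]
        have := int_sq_mod_three u; have := int_sq_mod_three w
        push_cast at h ⊢
        omega
      · zify
        simpa using h
    · rintro ⟨a, b, ⟨-, -, h⟩, rfl, rfl⟩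
      rw [← h]
      simp
  have hpos : ∀ v ∈ P, 0 < v.1 ∧ 0 < v.2 := by
    rintro ⟨a, b⟩ ⟨⟨-, ha⟩, hb, -⟩
    constructor <;> rw [Nat.pos_iff_ne_zero] <;> rintro h <;> simp_all
  rw [ncard_normReps_one hn, ncard_normReps_one hM, hset, ncard_signed hpos one_pos one_pos]
    at hdvd
  obtain ⟨c, hc⟩ := even_ncard_normReps (d := 4) (by norm_num) hM.pos
  obtain ⟨j, hj⟩ := h
  obtain ⟨i, hi⟩ := hdvd
  rw [hc] at hi
  have : 16 * (c * i) = 8 * (2 * j + 1) := by rw [← hj]; linarith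
  omega

/-- Integers with an odd number of representations `9 s² + 2 r²`, `r`, `s` odd, `3 ∤ r`. -/
theorem prime_mul_sq_of_odd_ncard_nine_two {n : ℕ}
    (h : Odd {v : ℕ × ℕ | Odd v.1 ∧ (Odd v.2 ∧ ¬ 3 ∣ v.2) ∧ 9 * v.1 ^ 2 + 2 * v.2 ^ 2 = n}.ncard) :
    ∃ p k : ℕ, p.Prime ∧ n = p * k ^ 2 := by
  set P := {v : ℕ × ℕ | Odd v.1 ∧ (Odd v.2 ∧ ¬ 3 ∣ v.2) ∧ 9 * v.1 ^ 2 + 2 * v.2 ^ 2 = n} with hP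
  obtain ⟨⟨s, r⟩, hs, ⟨hr, hr3⟩, hrt⟩ := Set.nonempty_of_ncard_ne_zero h.pos.ne'
  simp only at hs hr hr3 hrt
  have hn3 : n % 3 = 2 := by
    have := sq_mod_three hr3; omega
  have hn8 : n % 8 = 3 := by
    have := sq_mod_eight hr; have := sq_mod_eight hs; omega
  have hn : Odd n := by
    rw [Nat.odd_iff]; omega
  by_contra hpk
  obtain ⟨M, hM, hdvd⟩ := four_mul_ncard_dvd (Or.inr rfl) hn (not_isSquare_of_mod_three hn3) hpk
  have hset : normReps 2 n =
      {w : ℤ × ℤ | ∃ v ∈ P, w.1.natAbs = 3 * v.1 ∧ w.2.natAbs = 1 * v.2} := by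
    ext ⟨u, w⟩
    simp only [normReps, Set.mem_ofPred_eq, one_mul, Prod.exists]
    constructor
    · intro h
      push_cast at h
      have h1 := int_sq_mod_three u
      have h2 := int_sq_mod_three w
      have h3 := int_sq_mod_eight u
      have h4 := int_sq_mod_eight w
      have hu3 : (3 : ℤ) ∣ u := by omega
      have hw3 : ¬ (3 : ℤ) ∣ w := by omega
      have hu2 : Odd u := by
        rcases h3 with h' | h'
        · exact h'.1
        · omega
      have hw2 : Odd w := by
        rcases h4 with h' | h'
        · exact h'.1
        · omega
      obtain ⟨z, rfl⟩ := hu3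
      refine ⟨z.natAbs, w.natAbs, ⟨?_, ⟨?_, ?_⟩, ?_⟩, ?_, rfl⟩
      · rw [Int.natAbs_odd]
        exact (Int.odd_mul.mp hu2).2
      · rwa [Int.natAbs_odd]
      · rwa [← Int.natCast_dvd]
      · zify
        simp only [sq_abs]
        linarith
      · simp [Int.natAbs_mul]
    · rintro ⟨a, b, ⟨-, -, h⟩, h1, rfl⟩
      rw [← h, ← Int.natAbs_sq u, h1]
      push_cast
      rw [sq_abs]
      ring
  have hpos : ∀ v ∈ P, 0 < v.1 ∧ 0 < v.2 := by
    rintro ⟨a, b⟩ ⟨ha, ⟨hb, -⟩, -⟩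
    exact ⟨ha.pos, hb.pos⟩
  rw [hset, ncard_signed hpos (by norm_num) one_pos] at hdvd
  obtain ⟨c, hc⟩ := even_ncard_normReps (d := 2) (by norm_num) hM.pos
  obtain ⟨j, hj⟩ := h
  obtain ⟨i, hi⟩ := hdvd
  rw [hc] at hi
  have : 8 * (c * i) = 4 * (2 * j + 1) := by rw [← hj]; linarith
  omega

theorem four_dvd_ncard_normReps_two {m : ℕ} (hm : Odd m) (hsq : ¬ IsSquare m) :
    4 ∣ (normReps 2 m).ncard := by
  set P := {v : ℕ × ℕ | 0 < v.1 ∧ 0 < v.2 ∧ v.1 ^ 2 + 2 * v.2 ^ 2 = m} with hP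
  have hset : normReps 2 m =
      {w : ℤ × ℤ | ∃ v ∈ P, w.1.natAbs = 1 * v.1 ∧ w.2.natAbs = 1 * v.2} := by
    ext ⟨u, w⟩
    simp only [normReps, Set.mem_ofPred_eq, one_mul, Prod.exists, hP]
    constructor
    · intro h
      have h' : u.natAbs ^ 2 + 2 * w.natAbs ^ 2 = m := by zify; simpa using h
      refine ⟨u.natAbs, w.natAbs, ⟨?_, ?_, h'⟩, rfl, rfl⟩
      · rw [Nat.pos_iff_ne_zero]
        intro h0
        rw [h0] at h'
        rw [Nat.odd_iff] at hm
        omega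
      · rw [Nat.pos_iff_ne_zero]
        intro h0
        exact hsq ⟨u.natAbs, by rw [← h', h0]; ring⟩
    · rintro ⟨a, b, ⟨-, -, h⟩, rfl, rfl⟩
      rw [← h]
      simp
  rw [hset, ncard_signed (fun v hv => ⟨hv.1, hv.2.1⟩) one_pos one_pos]
  exact dvd_mul_right _ _

theorem ncard_normReps_two_sq {z : ℕ} (hz : Odd z) : (normReps 2 (z ^ 2)).ncard % 4 = 2 := by
  set P := {v : ℕ × ℕ | 0 < v.1 ∧ 0 < v.2 ∧ v.1 ^ 2 + 2 * v.2 ^ 2 = z ^ 2} with hP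
  have hz0 : (z : ℤ) ≠ 0 := by exact_mod_cast hz.pos.ne'
  have hset : normReps 2 (z ^ 2) =
      {w : ℤ × ℤ | ∃ v ∈ P, w.1.natAbs = 1 * v.1 ∧ w.2.natAbs = 1 * v.2} ∪
        {((z : ℤ), 0), (-(z : ℤ), 0)} := by
    ext ⟨u, w⟩
    simp only [normReps, Set.mem_ofPred_eq, one_mul, Prod.exists, hP, Set.mem_union,
      Set.mem_insert_iff, Set.mem_singleton_iff, Prod.mk.injEq]
    constructor
    · intro h
      by_cases hw : w = 0
      · right
        subst hw
        rw [← or_and_right]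
        refine ⟨sq_eq_sq_iff_eq_or_eq_neg.mp ?_, rfl⟩
        simpa using h
      · left
        have h' : u.natAbs ^ 2 + 2 * w.natAbs ^ 2 = z ^ 2 := by zify; simpa using h
        refine ⟨u.natAbs, w.natAbs, ⟨?_, Int.natAbs_pos.mpr hw, h'⟩, rfl, rfl⟩
        rw [Nat.pos_iff_ne_zero]
        intro h0
        rw [h0] at h'
        have := sq_mod_eight hz
        omega
    · rintro (⟨a, b, ⟨-, -, h⟩, rfl, rfl⟩ | ⟨rfl, rfl⟩ | ⟨rfl, rfl⟩)
      · rw [← h]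
        simp
      · simp
      · simp
  have hfin := normReps_finite (d := 2) (by norm_num) (z ^ 2)
  rw [hset] at hfin ⊢
  rw [Set.ncard_union_eq _ (hfin.subset Set.subset_union_left)
    (hfin.subset Set.subset_union_right), ncard_signed (fun v hv => ⟨hv.1, hv.2.1⟩) one_pos one_pos,
    Set.ncard_pair]
  · omega
  · simp only [ne_eq, Prod.mk.injEq, and_true]
    omega
  · rw [Set.disjoint_left]
    rintro ⟨u, w⟩ ⟨v, hv, -, h⟩ h'
    have hw : w = 0 := by
      simp only [Set.mem_insert_iff, Set.mem_singleton_iff, Prod.mk.injEq] at h'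
      omega
    have := hv.2.1
    rw [hw] at h
    simp at h
    omega

theorem two_mul_ncard_normReps_two {k m : ℕ} (hm : ¬ 3 ∣ m) (h8 : 3 ^ (k + 1) * m % 8 = 1) :
    4 * {v : ℕ × ℕ | (Odd v.1 ∧ ¬ 3 ∣ v.1) ∧ ¬ 3 ∣ v.2 ∧
      1 * v.1 ^ 2 + 8 * v.2 ^ 2 = 3 ^ (k + 1) * m}.ncard = 2 * (normReps 2 m).ncard := by
  set N := 3 ^ (k + 1) * m with hN
  have hN3 : N % 3 = 0 := by rw [hN, pow_succ']; simp [mul_assoc]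
  set P := {v : ℕ × ℕ | (Odd v.1 ∧ ¬ 3 ∣ v.1) ∧ ¬ 3 ∣ v.2 ∧ 1 * v.1 ^ 2 + 8 * v.2 ^ 2 = N} with hP
  have hpos : ∀ v ∈ P, 0 < v.1 ∧ 0 < v.2 := by
    rintro ⟨a, b⟩ ⟨⟨-, ha⟩, hb, -⟩
    constructor <;> rw [Nat.pos_iff_ne_zero] <;> rintro h <;> simp_all
  set D := {v | v ∈ normReps 2 N ∧ (3 : ℤ) ∣ v.1 ∧ (3 : ℤ) ∣ v.2} with hD
  have hset : {w : ℤ × ℤ | ∃ v ∈ P, w.1.natAbs = 1 * v.1 ∧ w.2.natAbs = 2 * v.2} =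
      normReps 2 N \ D := by
    ext ⟨u, w⟩
    simp only [normReps, Set.mem_sdiff, Set.mem_ofPred_eq, one_mul, Prod.exists, hP, hD, not_and]
    constructor
    · rintro ⟨a, b, ⟨⟨-, ha⟩, -, h⟩, rfl, h2⟩
      refine ⟨?_, fun _ h3 => absurd (Int.natCast_dvd.mp h3) ha⟩
      rw [← h, ← Int.natAbs_sq w, h2]
      push_cast
      rw [sq_abs]
      ring
    · rintro ⟨h, hnd⟩
      have hnd' := hnd h
      push_cast at h
      have h1 := int_sq_mod_three u
      have h2 := int_sq_mod_three w
      have h3 := int_sq_mod_eight u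
      have h4 := int_sq_mod_eight w
      have hu3 : ¬ (3 : ℤ) ∣ u := by omega
      have hw3 : ¬ (3 : ℤ) ∣ w := by omega
      have hu2 : Odd u := by
        rcases h3 with h' | h'
        · exact h'.1
        · omega
      have hw2 : Even w := by
        rcases h4 with h' | h'
        · omega
        · exact h'.1
      obtain ⟨z, rfl⟩ := hw2.two_dvd
      refine ⟨u.natAbs, z.natAbs, ⟨⟨?_, ?_⟩, ?_, ?_⟩, rfl, ?_⟩
      · rwa [Int.natAbs_odd]
      · rwa [← Int.natCast_dvd]
      · rw [← Int.natCast_dvd]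
        exact fun h => hw3 (h.mul_left 2)
      · zify
        simp only [sq_abs]
        linarith
      · simp [Int.natAbs_mul]
  have hr := ncard_normReps_pow_mul (d := 2) (p := 3) (x := 1) (y := 1) (by norm_num)
    Nat.prime_three (by norm_num) (by norm_num) hm
  have hDcard : D.ncard = k * (normReps 2 m).ncard := by
    rcases k with _ | k
    · rw [zero_mul, Set.ncard_eq_zero ((normReps_finite (by norm_num) N).subset fun v hv => hv.1),
        Set.eq_empty_iff_forall_notMem]
      rintro ⟨u, w⟩ ⟨h, ⟨a, rfl⟩, b, rfl⟩
      have h' : (3 * a) ^ 2 + (2 : ℕ) * (3 * b) ^ 2 = (N : ℤ) := h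
      rw [hN] at h'
      push_cast at h'
      apply hm
      zify
      exact ⟨a ^ 2 + 2 * b ^ 2, by linarith⟩
    · rw [← hr k, ← ncard_image_smul (M := 3 ^ k * m) three_ne_zero,
        ← setOf_dvd_normReps three_ne_zero, hD, hN,
        show 3 ^ (k + 1 + 1) * m = 3 * (3 * (3 ^ k * m)) by ring]
      rfl
  rw [← ncard_signed hpos one_pos two_pos, hset,
    Set.ncard_sdiff (fun v hv => hv.1) ((normReps_finite (by norm_num) N).subset fun v hv => hv.1),
    hDcard, hN, hr (k + 1), ← Nat.sub_mul]
  congr 1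
  omega

/-- The number of representations `r² + 8 t²` with `r` odd, `3 ∤ r t` is odd precisely for
the integers `9 s²`, `s` odd. -/
theorem odd_ncard_one_eight_iff {N : ℕ} :
    Odd {v : ℕ × ℕ | (Odd v.1 ∧ ¬ 3 ∣ v.1) ∧ ¬ 3 ∣ v.2 ∧ 1 * v.1 ^ 2 + 8 * v.2 ^ 2 = N}.ncard ↔
      ∃ s, Odd s ∧ 9 * s ^ 2 = N := by
  constructor
  · intro h
    obtain ⟨⟨r, t⟩, ⟨hr, hr3⟩, ht3, hrt⟩ := Set.nonempty_of_ncard_ne_zero h.pos.ne'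
    simp only at hr hr3 ht3 hrt
    have hN8 : N % 8 = 1 := by have := sq_mod_eight hr; omega
    have hN3 : 3 ∣ N := by have := sq_mod_three hr3; have := sq_mod_three ht3; omega
    obtain ⟨k, m, hm, rfl⟩ := Nat.exists_eq_pow_mul_and_not_dvd (n := N) (by omega) 3 (by norm_num)
    rcases k with _ | k
    · simp at hN3; exact absurd hN3 hm
    have hcard := two_mul_ncard_normReps_two hm hN8
    have hm2 : Odd m := by
      have : Odd (3 ^ (k + 1) * m) := by rw [Nat.odd_iff]; omega
      exact (Nat.odd_mul.mp this).2
    have hmsq : IsSquare m := by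
      by_contra hsq
      have := four_dvd_ncard_normReps_two hm2 hsq
      obtain ⟨j, hj⟩ := h
      omega
    obtain ⟨z, rfl⟩ := hmsq
    have hz : Odd z := (Nat.odd_mul.mp hm2).1
    rcases Nat.even_or_odd' k with ⟨j, rfl | rfl⟩
    · have h1 : 3 ^ (2 * j + 1) * (z * z) = 3 * (3 ^ j * z) ^ 2 := by ring
      have h2 := sq_mod_eight (r := 3 ^ j * z) ((Odd.pow (by decide)).mul hz)
      omega
    · exact ⟨3 ^ j * z, (Odd.pow (by decide)).mul hz, by ring⟩
  · rintro ⟨s, hs, rfl⟩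
    obtain ⟨j, z, hz3, rfl⟩ := Nat.exists_eq_pow_mul_and_not_dvd hs.pos.ne' 3 (by norm_num)
    have hz : Odd z := (Nat.odd_mul.mp hs).2
    have h8 := sq_mod_eight hs
    have e : 9 * (3 ^ j * z) ^ 2 = 3 ^ (2 * j + 1 + 1) * z ^ 2 := by ring
    have hcard := two_mul_ncard_normReps_two (k := 2 * j + 1) (m := z ^ 2)
      (fun h => hz3 (Nat.prime_three.dvd_of_dvd_pow h)) (by rw [← e]; omega)
    have := ncard_normReps_two_sq hz
    rw [e, Nat.odd_iff]
    omega

/-- The series `∑ x^(c m²)` over `m ∈ T`. -/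
noncomputable def squareSeries (c : ℕ) (T : Set ℕ) : PowerSeries (ZMod 2) :=
  PowerSeries.mk fun k => if ∃ m ∈ T, c * m ^ 2 = k then 1 else 0

theorem coeff_squareSeries (c : ℕ) (T : Set ℕ) (k : ℕ) :
    PowerSeries.coeff k (squareSeries c T) = if ∃ m ∈ T, c * m ^ 2 = k then 1 else 0 :=
  PowerSeries.coeff_mk _ _

theorem coeff_squareSeries_mul {c d : ℕ} (hc : 0 < c) (hd : 0 < d) (T U : Set ℕ) (n : ℕ) :
    PowerSeries.coeff n (squareSeries c T * squareSeries d U) =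
      ({v : ℕ × ℕ | v.1 ∈ T ∧ v.2 ∈ U ∧ c * v.1 ^ 2 + d * v.2 ^ 2 = n}.ncard : ZMod 2) := by
  rw [PowerSeries.coeff_mul]
  simp only [coeff_squareSeries, mul_ite, mul_one, mul_zero, ← ite_and]
  rw [Finset.sum_boole, ← Set.ncard_coe_finset]
  congr 1
  symm
  have inj : ∀ {c a b : ℕ}, 0 < c → c * a ^ 2 = c * b ^ 2 → a = b := fun hc h =>
    Nat.pow_left_injective two_ne_zero (Nat.eq_of_mul_eq_mul_left hc h)
  refine Set.ncard_congr (fun v _ => (c * v.1 ^ 2, d * v.2 ^ 2)) ?_ ?_ ?_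
  · rintro ⟨r, s⟩ ⟨hr, hs, h⟩
    simp only [Finset.coe_filter, Finset.HasAntidiagonal.mem_antidiagonal, Set.mem_ofPred_eq]
    exact ⟨h, ⟨s, hs, rfl⟩, r, hr, rfl⟩
  · rintro ⟨r, s⟩ ⟨r', s'⟩ - - h
    simp only [Prod.mk.injEq] at h
    rw [inj hc h.1, inj hd h.2]
  · rintro ⟨i, j⟩ h
    simp only [Finset.coe_filter, Finset.HasAntidiagonal.mem_antidiagonal, Set.mem_ofPred_eq] at h
    obtain ⟨h, ⟨s, hs, rfl⟩, r, hr, rfl⟩ := h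
    exact ⟨(r, s), ⟨hr, hs, h⟩, rfl⟩

theorem coeff_sq_zmod_two (f : PowerSeries (ZMod 2)) (n : ℕ) :
    PowerSeries.coeff n (f ^ 2) = if Even n then PowerSeries.coeff (n / 2) f else 0 := by
  rw [pow_two, PowerSeries.coeff_mul]
  have hinv : ∀ s : Finset (ℕ × ℕ), (∀ v ∈ s, v.swap ∈ s) → (∀ v ∈ s, v.1 ≠ v.2) →
      ∑ v ∈ s, PowerSeries.coeff v.1 f * PowerSeries.coeff v.2 f = 0 := by
    intro s hs hne
    refine Finset.sum_involution (fun v _ => v.swap) ?_ ?_ hs (fun v _ => v.swap_swap)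
    · intro v _
      rw [Prod.fst_swap, Prod.snd_swap, mul_comm]
      exact CharTwo.add_self_eq_zero _
    · intro v hv _ h
      exact hne v hv (congrArg Prod.snd h)
  split_ifs with h
  · obtain ⟨k, rfl⟩ := h.two_dvd
    have hmem : (k, k) ∈ Finset.HasAntidiagonal.antidiagonal (2 * k) := by
      rw [Finset.HasAntidiagonal.mem_antidiagonal]; ring
    rw [← Finset.add_sum_erase _ _ hmem, hinv, add_zero, Nat.mul_div_cancel_left k two_pos]
    · generalize PowerSeries.coeff k f = z
      revert z; decide
    · rintro ⟨i, j⟩ hv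
      simp only [Finset.mem_erase, Finset.HasAntidiagonal.mem_antidiagonal, Prod.swap_prod_mk, ne_eq,
        Prod.mk.injEq] at hv ⊢
      omega
    · rintro ⟨i, j⟩ hv
      simp only [Finset.mem_erase, Finset.HasAntidiagonal.mem_antidiagonal, ne_eq, Prod.mk.injEq] at hv ⊢
      omega
  · refine hinv _ (fun v hv => ?_) (fun v hv heq => h ?_)
    · rw [Finset.HasAntidiagonal.mem_antidiagonal] at hv ⊢
      rw [← hv, Prod.fst_swap, Prod.snd_swap, add_comm]
    · rw [Finset.HasAntidiagonal.mem_antidiagonal] at hv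
      exact ⟨v.1, by rw [← hv, heq]⟩

theorem squareSeries_sq (c : ℕ) (T : Set ℕ) : squareSeries c T ^ 2 = squareSeries (2 * c) T := by
  ext n
  rw [coeff_sq_zmod_two, coeff_squareSeries, coeff_squareSeries, ← ite_and]
  refine if_congr ⟨?_, ?_⟩ rfl rfl
  · rintro ⟨hn, m, hm, h⟩
    refine ⟨m, hm, ?_⟩
    rw [Nat.even_iff] at hn
    rw [mul_assoc]
    omega
  · rintro ⟨m, hm, rfl⟩
    refine ⟨by simp [mul_assoc], m, hm, ?_⟩
    rw [mul_assoc, Nat.mul_div_cancel_left _ two_pos]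

/-- All exponents occurring in `f` are congruent to `j` modulo `m`. -/
def SupportedMod (m j : ℕ) (f : PowerSeries (ZMod 2)) : Prop :=
  ∀ n, PowerSeries.coeff n f ≠ 0 → n ≡ j [MOD m]

theorem SupportedMod.mul {m i j : ℕ} {f g : PowerSeries (ZMod 2)} (hf : SupportedMod m i f)
    (hg : SupportedMod m j g) : SupportedMod m (i + j) (f * g) := by
  intro n hn
  rw [PowerSeries.coeff_mul] at hn
  obtain ⟨v, hv, h⟩ := Finset.exists_ne_zero_of_sum_ne_zero hn
  rw [← Finset.HasAntidiagonal.mem_antidiagonal.mp hv]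
  exact (hf _ (left_ne_zero_of_mul h)).add (hg _ (right_ne_zero_of_mul h))

theorem SupportedMod.pow {m i : ℕ} {f : PowerSeries (ZMod 2)} (hf : SupportedMod m i f) (k : ℕ) :
    SupportedMod m (k * i) (f ^ k) := by
  induction k with
  | zero =>
    intro n hn
    rw [pow_zero, PowerSeries.coeff_one] at hn
    simp only [ne_eq, ite_eq_right_iff, one_ne_zero, imp_false, not_not] at hn
    simp [hn, Nat.ModEq.refl]
  | succ k ih =>
    rw [pow_succ, add_mul, one_mul]
    exact ih.mul hf

theorem SupportedMod.sq {m : ℕ} {f : PowerSeries (ZMod 2)} (hf : SupportedMod m 0 f) :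
    SupportedMod (2 * m) 0 (f ^ 2) := by
  intro n hn
  rw [coeff_sq_zmod_two] at hn
  split_ifs at hn with h
  · obtain ⟨k, rfl⟩ := h.two_dvd
    rw [Nat.mul_div_cancel_left k two_pos] at hn
    exact (hf k hn).mul_left' 2
  · exact absurd rfl hn

theorem theta_three_one_eq : theta 3 1 = squareSeries 1 {m | ¬ 3 ∣ m} := by
  ext k
  rw [coeff_squareSeries, theta, PowerSeries.coeff_mk]
  split_ifs with h
  · obtain ⟨m, hm, rfl⟩ := h
    have hm' : ¬ 3 ∣ m := hm
    obtain ⟨z, hz, hzm⟩ : ∃ z : ℤ, z ≡ 1 [ZMOD 3] ∧ z.natAbs = m := by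
      have : m % 3 = 1 ∨ m % 3 = 2 := by omega
      rcases this with h | h
      · exact ⟨m, by rw [Int.ModEq]; omega, by simp⟩
      · exact ⟨-m, by rw [Int.ModEq]; omega, by simp⟩
    have hset : {n : ℤ | n ≡ 1 [ZMOD 3] ∧ n ^ 2 = ((1 * m ^ 2 : ℕ) : ℤ)} = {z} := by
      ext n
      simp only [Set.mem_ofPred_eq, Set.mem_singleton_iff]
      constructor
      · rintro ⟨hn, h⟩
        have h2 : n ^ 2 = z ^ 2 := by
          rw [h, ← hzm]; push_cast; rw [sq_abs, one_mul]
        rw [Int.ModEq] at hn hz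
        rcases sq_eq_sq_iff_eq_or_eq_neg.mp h2 with h3 | h3 <;> omega
      · rintro rfl
        refine ⟨hz, ?_⟩
        rw [← hzm]; push_cast; rw [sq_abs, one_mul]
    rw [hset, Set.ncard_singleton, Nat.cast_one]
  · convert Nat.cast_zero
    convert Set.ncard_empty ℤ
    rw [Set.eq_empty_iff_forall_notMem]
    rintro n ⟨hn, hk⟩
    refine h ⟨n.natAbs, ?_, ?_⟩
    · change ¬ 3 ∣ n.natAbs
      rw [Int.ModEq] at hn
      omega
    · zify
      rw [sq_abs, one_mul, hk]

theorem theta_three_one_split : theta 3 1 =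
    theta 3 1 ^ 4 + squareSeries 1 {m | Odd m ∧ ¬ 3 ∣ m} := by
  rw [show theta 3 1 ^ 4 = (theta 3 1 ^ 2) ^ 2 by ring, theta_three_one_eq, squareSeries_sq,
    squareSeries_sq]
  ext k
  rw [map_add, coeff_squareSeries, coeff_squareSeries, coeff_squareSeries]
  by_cases h1 : ∃ m ∈ {m | ¬ 3 ∣ m}, 2 * (2 * 1) * m ^ 2 = k
  · rw [if_pos h1]
    obtain ⟨m, hm, rfl⟩ := h1
    have hm' : ¬ 3 ∣ m := hm
    have hm2 : 2 * m ∈ {m | ¬ 3 ∣ m} := fun h => hm' (by omega)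
    rw [if_pos ⟨2 * m, hm2, by ring⟩, if_neg, add_zero]
    rintro ⟨r, ⟨hr, -⟩, h⟩
    have := sq_mod_eight hr
    omega
  · rw [if_neg h1, zero_add]
    refine if_congr ⟨?_, ?_⟩ rfl rfl
    · rintro ⟨m, hm, h⟩
      refine ⟨m, ⟨?_, hm⟩, h⟩
      by_contra hodd
      obtain ⟨t, rfl⟩ := (Nat.not_odd_iff_even.mp hodd).two_dvd
      exact h1 ⟨t, fun h' => hm (h'.mul_left 2), by rw [← h]; ring⟩
    · rintro ⟨m, ⟨-, hm⟩, h⟩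
      exact ⟨m, hm, h⟩

theorem squareSeries_mul_theta_pow_eight :
    squareSeries 1 {m | Odd m ∧ ¬ 3 ∣ m} * theta 3 1 ^ 8 = squareSeries 9 {m | Odd m} := by
  rw [show theta 3 1 ^ 8 = ((theta 3 1 ^ 2) ^ 2) ^ 2 by ring, theta_three_one_eq, squareSeries_sq,
    squareSeries_sq, squareSeries_sq]
  ext k
  rw [coeff_squareSeries_mul one_pos (by norm_num), coeff_squareSeries]
  have key := odd_ncard_one_eight_iff (N := k)
  split_ifs with h
  · exact ZMod.natCast_eq_one_iff_odd.mpr (key.mpr h)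
  · rw [ZMod.natCast_eq_zero_iff_even, ← Nat.not_odd_iff_even]
    exact fun h' => h (key.mp h')

theorem supportedMod_eight_one :
    SupportedMod 8 1 (squareSeries 1 {m | Odd m ∧ ¬ 3 ∣ m}) := by
  intro n hn
  rw [coeff_squareSeries] at hn
  split_ifs at hn with h
  · obtain ⟨m, ⟨hm, -⟩, rfl⟩ := h
    rw [one_mul]
    exact sq_mod_eight hm
  · exact absurd rfl hn

theorem exists_theta_mul_eq_X : ∃ v : PowerSeries (ZMod 2), theta 3 1 * v = PowerSeries.X := by
  have h0 : PowerSeries.constantCoeff (theta 3 1) = 0 := by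
    rw [← PowerSeries.coeff_zero_eq_constantCoeff_apply, theta_three_one_eq, coeff_squareSeries,
      if_neg]
    rintro ⟨m, hm, h⟩
    obtain rfl : m = 0 := by simpa using h
    exact hm (dvd_zero 3)
  obtain ⟨w, hw⟩ := PowerSeries.X_dvd_iff.mpr h0
  have h1 : PowerSeries.constantCoeff w ≠ 0 := by
    have : PowerSeries.coeff 1 (theta 3 1) = 1 := by
      rw [theta_three_one_eq, coeff_squareSeries, if_pos ⟨1, by simp, by simp⟩]
    rw [hw, show 1 = 0 + 1 from rfl, PowerSeries.coeff_succ_X_mul,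
      PowerSeries.coeff_zero_eq_constantCoeff_apply] at this
    rw [this]; exact one_ne_zero
  exact ⟨w⁻¹, by rw [hw, mul_assoc, PowerSeries.mul_inv_cancel _ h1, mul_one]⟩

theorem coeff_inv_eq {g v : PowerSeries (ZMod 2)} (h : g * v = PowerSeries.X) (n : ℕ) :
    ((g : LaurentSeries (ZMod 2))⁻¹).coeff n = PowerSeries.coeff (n + 1) v := by
  have hL : (g : LaurentSeries (ZMod 2)) * (v : LaurentSeries (ZMod 2)) = HahnSeries.single 1 1 := by
    rw [← HahnSeries.ofPowerSeries_X, ← h, map_mul]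
  have hg : (g : LaurentSeries (ZMod 2))⁻¹ = HahnSeries.single (-1) 1 * (v : LaurentSeries (ZMod 2)) := by
    symm
    apply eq_inv_of_mul_eq_one_left
    rw [mul_assoc, mul_comm (v : LaurentSeries (ZMod 2)), hL, HahnSeries.single_mul_single]
    simp
  rw [hg, show (n : ℤ) = ((n + 1 : ℕ) : ℤ) + -1 by push_cast; ring,
    HahnSeries.coeff_single_mul_add, one_mul]
  exact LaurentSeries.coeff_coe_powerSeries _ _

theorem coeff_inv_theta {n : ℕ} (hn : n % 8 ≠ 7) :
    ((theta 3 1 : LaurentSeries (ZMod 2))⁻¹).coeff n =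
      PowerSeries.coeff n (squareSeries 2 {m | ¬ 3 ∣ m} +
        squareSeries 1 {m | Odd m ∧ ¬ 3 ∣ m} * squareSeries 4 {m | ¬ 3 ∣ m} +
        squareSeries 9 {m | Odd m} * squareSeries 2 {m | Odd m ∧ ¬ 3 ∣ m}) := by
  obtain ⟨v, hv⟩ := exists_theta_mul_eq_X
  have h2 : squareSeries 2 {m | ¬ 3 ∣ m} = theta 3 1 ^ 2 := by
    rw [theta_three_one_eq, squareSeries_sq]
  have h4 : squareSeries 4 {m | ¬ 3 ∣ m} = theta 3 1 ^ 4 := by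
    rw [show theta 3 1 ^ 4 = (theta 3 1 ^ 2) ^ 2 by ring, ← h2, squareSeries_sq]
  have ho := squareSeries_sq 1 {m | Odd m ∧ ¬ 3 ∣ m}
  rw [mul_one] at ho
  rw [coeff_inv_eq hv, h2, h4, ← squareSeries_mul_theta_pow_eight, ← ho]
  have hsplit := theta_three_one_split
  have hsupp := supportedMod_eight_one
  set a := theta 3 1
  set o := squareSeries 1 {m | Odd m ∧ ¬ 3 ∣ m}
  have two : (2 : PowerSeries (ZMod 2)) = 0 := by
    rw [← map_ofNat (PowerSeries.C (R := ZMod 2)) 2, show (OfNat.ofNat 2 : ZMod 2) = 0 from rfl, map_zero]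
  have hoa : o = a + a ^ 4 := by linear_combination -hsplit - a ^ 4 * two
  have key : PowerSeries.X ^ 7 * v =
      PowerSeries.X ^ 8 * (a ^ 2 + o * a ^ 4 + o * a ^ 8 * o ^ 2) + o ^ 7 * v ^ 8 := by
    rw [← hv, hoa]
    linear_combination -(4*a^10 + 11*a^13 + 18*a^16 + 18*a^19 + 12*a^22 + 5*a^25 + a^28) * v^8 * two
  have hvs : SupportedMod 8 0 (v ^ 8) := by
    rw [show v ^ 8 = ((v ^ 2) ^ 2) ^ 2 by ring]
    have h1 : SupportedMod 1 0 v := fun n _ => Nat.modEq_one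
    exact h1.sq.sq.sq
  have hz : PowerSeries.coeff (n + 8) (o ^ 7 * v ^ 8) = 0 := by
    by_contra h
    have := (hsupp.pow 7).mul hvs _ h
    rw [Nat.ModEq] at this
    omega
  have hc := congrArg (PowerSeries.coeff (n + 8)) key
  rw [map_add, hz, add_zero, PowerSeries.coeff_X_pow_mul, show n + 8 = (n + 1) + 7 by ring,
    PowerSeries.coeff_X_pow_mul] at hc
  exact hc

theorem prime_mul_sq_of_mem_Bset {n : ℕ} (hn : n % 8 ≠ 7) (h : (n : ℤ) ∈ Bset (theta 3 1)) :
    ∃ p k : ℕ, p.Prime ∧ n = p * k ^ 2 := by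
  have h1 : ((theta 3 1 : LaurentSeries (ZMod 2))⁻¹).coeff n = 1 := h
  rw [coeff_inv_theta hn, map_add, map_add, coeff_squareSeries_mul one_pos (by norm_num),
    coeff_squareSeries_mul (by norm_num) two_pos] at h1
  by_cases ha : ∃ m ∈ {m | ¬ 3 ∣ m}, 2 * m ^ 2 = n
  · obtain ⟨m, -, rfl⟩ := ha
    exact ⟨2, m, Nat.prime_two, rfl⟩
  rw [coeff_squareSeries, if_neg ha, zero_add, ← Nat.cast_add, ZMod.natCast_eq_one_iff_odd,
    Nat.odd_add] at h1
  rcases Nat.even_or_odd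
    {v : ℕ × ℕ | (Odd v.1 ∧ ¬ 3 ∣ v.1) ∧ ¬ 3 ∣ v.2 ∧ 1 * v.1 ^ 2 + 4 * v.2 ^ 2 = n}.ncard with he | he
  · refine prime_mul_sq_of_odd_ncard_nine_two (n := n) ?_
    by_contra hb
    rw [Nat.not_odd_iff_even] at hb
    exact Nat.not_odd_iff_even.mpr he (h1.mpr hb)
  · exact prime_mul_sq_of_odd_ncard_one_four he

theorem mod_eight_ne_seven {n : ℕ} (h : (n : ℤ) ∈ Ustar3) : n % 8 ≠ 7 := by
  obtain ⟨-, h⟩ := h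
  omega

theorem primeCounting_floor_le {y : ℝ} (hy : 2 ≤ y) :
    (Nat.primeCounting ⌊y⌋₊ : ℝ) ≤ (2 * Real.log 4 + 2) * (y / Real.log y) := by
  have h := Chebyshev.pi_le_log4_mul_div (x := y) (by linarith)
  have hl : 0 < Real.log y := Real.log_pos (by linarith)
  have hs : 0 < √y := Real.sqrt_pos.mpr (by linarith)
  have hlog : Real.log √y = Real.log y / 2 := Real.log_sqrt (by linarith)
  have hle : Real.log y ≤ 2 * √y := by
    have := Real.log_le_self hs.le
    linarith
  have hsq : √y ≤ 2 * (y / Real.log y) := by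
    rw [mul_div_assoc', le_div_iff₀ hl]
    nlinarith [Real.mul_self_sqrt (show 0 ≤ y by linarith)]
  have : Real.log 4 * y / Real.log √y = 2 * Real.log 4 * (y / Real.log y) := by
    rw [hlog]; field_simp
  linarith

theorem primeCounting_div_sq_le {N k : ℕ} (hN : 2 ≤ N) (hk : 1 ≤ k) :
    (Nat.primeCounting (N / k ^ 2) : ℝ) ≤
      9 * (2 * Real.log 4 + 2) * (N / Real.log N) * (1 / (k : ℝ) ^ (3 / 2 : ℝ)) := by
  have hlN : 0 < Real.log N := Real.log_pos (by exact_mod_cast hN)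
  have hl4 : 0 < Real.log 4 := Real.log_pos (by norm_num)
  have hk0 : (0 : ℝ) < k := by exact_mod_cast hk
  by_cases h2 : N / k ^ 2 < 2
  · have h0 : Nat.primeCounting (N / k ^ 2) = 0 := Nat.primeCounting_eq_zero_iff.mpr (by omega)
    rw [h0, Nat.cast_zero]
    positivity
  set y : ℝ := (N : ℝ) / (k : ℝ) ^ 2 with hy
  have hfloor : ⌊y⌋₊ = N / k ^ 2 := by
    rw [hy, ← Nat.cast_pow, Nat.floor_div_eq_div]
  have hy2 : 2 ≤ y := by
    have : (2 : ℝ) ≤ ⌊y⌋₊ := by rw [hfloor]; exact_mod_cast not_lt.mp h2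
    exact this.trans (Nat.floor_le (by positivity))
  rw [← hfloor]
  refine (primeCounting_floor_le hy2).trans ?_
  have hly : 1 / 2 ≤ Real.log y := by
    have := Real.log_le_log two_pos hy2
    linarith [Real.log_two_gt_d9]
  have hs : 1 ≤ √(k : ℝ) := Real.one_le_sqrt.mpr (by exact_mod_cast hk)
  have hlogk : Real.log k ≤ 2 * √(k : ℝ) := by
    have h1 := Real.log_le_self (Real.sqrt_nonneg (k : ℝ))
    rw [Real.log_sqrt hk0.le] at h1
    linarith
  have hlog : Real.log N = Real.log y + 2 * Real.log k := by
    rw [hy, Real.log_div (by positivity) (by positivity), Real.log_pow]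
    push_cast; ring
  have hle : Real.log N ≤ 9 * √(k : ℝ) * Real.log y := by
    nlinarith
  have hpow : 1 / (k : ℝ) ^ (3 / 2 : ℝ) = √(k : ℝ) / (k : ℝ) ^ 2 := by
    rw [Real.sqrt_eq_rpow, ← Real.rpow_natCast, ← Real.rpow_sub hk0, one_div, ← Real.rpow_neg hk0.le]
    norm_num
  have hmain : y / Real.log y ≤ 9 * (N / Real.log N) * (1 / (k : ℝ) ^ (3 / 2 : ℝ)) := by
    rw [hpow, div_le_iff₀ (by linarith), hy]
    have : 9 * ((N : ℝ) / Real.log N) * (√(k : ℝ) / (k : ℝ) ^ 2) * Real.log y =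
        (N : ℝ) / (k : ℝ) ^ 2 * (9 * √(k : ℝ) * Real.log y / Real.log N) := by
      field_simp
    rw [this]
    exact le_mul_of_one_le_right (by positivity) ((one_le_div hlN).mpr hle)
  calc _ ≤ (2 * Real.log 4 + 2) * (9 * (N / Real.log N) * (1 / (k : ℝ) ^ (3 / 2 : ℝ))) := by
        gcongr
    _ = _ := by ring

theorem ncard_prime_mul_sq_le (N : ℕ) {S : Set ℤ}
    (hS : ∀ n ∈ S, n ≤ N ∧ ∃ p k : ℕ, p.Prime ∧ n = (p * k ^ 2 : ℕ)) :
    S.ncard ≤ 1 + ∑ k ∈ Finset.Icc 1 N, Nat.primeCounting (N / k ^ 2) := by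
  let F : Finset ℤ := insert 0 ((Finset.Icc 1 N).biUnion fun k =>
    ((Finset.range (N / k ^ 2 + 1)).filter Nat.Prime).image fun p => ((p * k ^ 2 : ℕ) : ℤ))
  have hsub : S ⊆ F := by
    intro n hn
    obtain ⟨hnN, p, k, hp, rfl⟩ := hS n hn
    have hnN' : p * k ^ 2 ≤ N := by exact_mod_cast hnN
    simp only [F, Finset.mem_coe, Finset.mem_insert, Finset.mem_biUnion, Finset.mem_image,
      Finset.mem_filter, Finset.mem_range, Finset.mem_Icc]
    rcases Nat.eq_zero_or_pos k with rfl | hk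
    · left; simp
    · refine Or.inr ⟨k, ⟨hk, ?_⟩, p, ⟨?_, hp⟩, rfl⟩
      · nlinarith [hp.pos]
      · rw [Nat.lt_succ_iff, Nat.le_div_iff_mul_le (by positivity)]
        exact hnN'
  calc S.ncard ≤ (F : Set ℤ).ncard := Set.ncard_le_ncard hsub (Finset.finite_toSet F)
    _ = F.card := Set.ncard_coe_finset F
    _ ≤ _ := by
      refine (Finset.card_insert_le _ _).trans ?_
      rw [add_comm]
      refine Nat.add_le_add_left (Finset.card_biUnion_le.trans (Finset.sum_le_sum fun k _ => ?_)) 1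
      refine Finset.card_image_le.trans ?_
      rw [Nat.primeCounting, Nat.primeCounting', Nat.count_eq_card_filter_range]

theorem exists_ncard_prime_mul_sq_le : ∃ C : ℝ, ∀ N : ℕ, 2 ≤ N → ∀ S : Set ℤ,
    (∀ n ∈ S, n ≤ N ∧ ∃ p k : ℕ, p.Prime ∧ n = (p * k ^ 2 : ℕ)) →
      (S.ncard : ℝ) ≤ C * N / Real.log N := by
  refine ⟨1 + 9 * (2 * Real.log 4 + 2) * ∑' k : ℕ, 1 / (k : ℝ) ^ (3 / 2 : ℝ), fun N hN S hS => ?_⟩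
  have hlN : 0 < Real.log N := Real.log_pos (by exact_mod_cast hN)
  have hl4 : 0 < Real.log 4 := Real.log_pos (by norm_num)
  have h1 : (1 : ℝ) ≤ N / Real.log N :=
    (one_le_div hlN).mpr (Real.log_le_self (Nat.cast_nonneg N))
  have hsum : Summable fun k : ℕ => 1 / (k : ℝ) ^ (3 / 2 : ℝ) :=
    Real.summable_one_div_nat_rpow.mpr (by norm_num)
  calc (S.ncard : ℝ) ≤ 1 + ∑ k ∈ Finset.Icc 1 N, (Nat.primeCounting (N / k ^ 2) : ℝ) := by
        exact_mod_cast ncard_prime_mul_sq_le N hS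
    _ ≤ N / Real.log N + ∑ k ∈ Finset.Icc 1 N,
        9 * (2 * Real.log 4 + 2) * (N / Real.log N) * (1 / (k : ℝ) ^ (3 / 2 : ℝ)) := by
        gcongr with k hk
        exact primeCounting_div_sq_le hN (Finset.mem_Icc.mp hk).1
    _ ≤ N / Real.log N + 9 * (2 * Real.log 4 + 2) * (N / Real.log N) *
        ∑' k : ℕ, 1 / (k : ℝ) ^ (3 / 2 : ℝ) := by
        rw [← Finset.mul_sum]
        gcongr
        exact hsum.sum_le_tsum _ fun k _ => by positivity
    _ = _ := by ring

theorem stmt7 :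
    (∀ n ∈ Bset (theta 3 1) ∩ Ustar3, ∃ p : ℕ, p.Prime ∧ ∃ k : ℤ, n = (p : ℤ) * k ^ 2) ∧
      ∃ C : ℝ, ∀ N : ℕ, 2 ≤ N →
        ({n : ℤ | n ∈ Bset (theta 3 1) ∧ n ∈ Ustar3 ∧ n ≤ (N : ℤ)}.ncard : ℝ) ≤
          C * N / Real.log N := by
  have key : ∀ n ∈ Bset (theta 3 1) ∩ Ustar3, ∃ p k : ℕ, p.Prime ∧ n = (p * k ^ 2 : ℕ) := by
    rintro n ⟨hB, hU⟩
    obtain ⟨m, rfl⟩ := Int.eq_ofNat_of_zero_le hU.1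
    obtain ⟨p, k, hp, h⟩ := prime_mul_sq_of_mem_Bset (mod_eight_ne_seven hU) hB
    exact ⟨p, k, hp, by rw [h]⟩
  refine ⟨fun n hn => ?_, ?_⟩
  · obtain ⟨p, k, hp, rfl⟩ := key n hn
    exact ⟨p, hp, k, by push_cast; rfl⟩
  · obtain ⟨C, hC⟩ := exists_ncard_prime_mul_sq_le
    exact ⟨C, fun N hN => hC N hN _ fun n hn => ⟨hn.2.2, key n ⟨hn.1, hn.2.1⟩⟩⟩
end

section
/- For all integers i and j, p_{2,0}([2i]·[2j]) = [i+j]²·[i−j]² in ℤ/2[[x]]. -/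
open scoped Classical

/-- Only finitely many integers have a given square. -/
theorem finite_setOf_modEq_sq_eq (l i k : ℤ) : {n : ℤ | n ≡ i [ZMOD l] ∧ n ^ 2 = k}.Finite :=
  (Set.finite_Icc (-k) k).subset fun n hn => by
    obtain ⟨-, hn⟩ := hn
    constructor <;> nlinarith [Int.le_self_sq n, Int.le_self_sq (-n)]

/-- The coefficients of a product of two theta series count representations as a sum of
two squares of integers in prescribed residue classes. -/
theorem coeff_theta_mul_theta (l i j : ℤ) (k : ℕ) :
    PowerSeries.coeff k (theta l i * theta l j) =
      (({p : ℤ × ℤ | p.1 ≡ i [ZMOD l] ∧ p.2 ≡ j [ZMOD l] ∧ p.1 ^ 2 + p.2 ^ 2 = (k : ℤ)}.ncard : ℕ) :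
        ZMod 2) := by
  set T : ℤ → ℕ → Finset ℤ := fun a n => (finite_setOf_modEq_sq_eq l a n).toFinset
  have hT (a : ℤ) (n : ℕ) : {x : ℤ | x ≡ a [ZMOD l] ∧ x ^ 2 = (n : ℤ)}.ncard = (T a n).card :=
    Set.ncard_eq_toFinset_card _ (finite_setOf_modEq_sq_eq l a n)
  have hmem (a n x) : x ∈ T a n ↔ x ≡ a [ZMOD l] ∧ x ^ 2 = (n : ℤ) :=
    Set.Finite.mem_toFinset _
  have hset : {p : ℤ × ℤ | p.1 ≡ i [ZMOD l] ∧ p.2 ≡ j [ZMOD l] ∧ p.1 ^ 2 + p.2 ^ 2 = (k : ℤ)} =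
      ((Finset.HasAntidiagonal.antidiagonal k).biUnion fun q => T i q.1 ×ˢ T j q.2 : Finset (ℤ × ℤ)) := by
    ext ⟨a, b⟩
    simp only [Set.mem_ofPred_eq, Finset.coe_biUnion, Set.mem_iUnion, Finset.mem_coe,
      Finset.mem_product, hmem, Finset.HasAntidiagonal.mem_antidiagonal, exists_prop, Prod.exists]
    constructor
    · rintro ⟨ha, hb, hab⟩
      refine ⟨(a ^ 2).toNat, (b ^ 2).toNat, ?_, ⟨ha, ?_⟩, hb, ?_⟩ <;>
        have := sq_nonneg a <;> have := sq_nonneg b <;> omega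
    · rintro ⟨u, v, huv, ⟨ha, hu⟩, hb, hv⟩
      exact ⟨ha, hb, by rw [hu, hv, ← huv, Nat.cast_add]⟩
  have hdisj : Set.PairwiseDisjoint (Finset.HasAntidiagonal.antidiagonal k : Set (ℕ × ℕ))
      fun q => T i q.1 ×ˢ T j q.2 := by
    rintro ⟨u, v⟩ - ⟨u', v'⟩ - hne
    rw [Function.onFun, Finset.disjoint_left]
    rintro ⟨a, b⟩ h h'
    simp only [Finset.mem_product, hmem] at h h'
    apply hne
    ext
    · exact Nat.cast_injective (R := ℤ) (h.1.2.symm.trans h'.1.2)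
    · exact Nat.cast_injective (R := ℤ) (h.2.2.symm.trans h'.2.2)
  rw [hset, Set.ncard_coe_finset, Finset.card_biUnion hdisj, PowerSeries.coeff_mul]
  simp [theta, hT, Finset.card_product]

/-- Squaring a power series over `ℤ/2` substitutes `X ^ 2` for `X`. -/
theorem powerSeries_zmod_two_sq (f : PowerSeries (ZMod 2)) :
    f ^ 2 = PowerSeries.expand 2 two_ne_zero f := by
  have h := MvPowerSeries.map_frobenius_expand (p := 2) two_ne_zero (f := f)
  rw [ZMod.frobenius_zmod] at h
  exact h.symm

/-- The rotation `(c, d) ↦ (c + d, c - d)` matches representations of `n` as a sum of two squares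
with representations of `2 * n`. -/
theorem ncard_sum_two_sq_two_mul {l : ℤ} (hl : Odd l) (i j n : ℤ) :
    {p : ℤ × ℤ | p.1 ≡ i + j [ZMOD l] ∧ p.2 ≡ i - j [ZMOD l] ∧ p.1 ^ 2 + p.2 ^ 2 = n}.ncard =
      {p : ℤ × ℤ | p.1 ≡ 2 * i [ZMOD l] ∧ p.2 ≡ 2 * j [ZMOD l] ∧
        p.1 ^ 2 + p.2 ^ 2 = 2 * n}.ncard := by
  have hcop : IsCoprime l 2 := Int.isCoprime_two_right.2 hl
  refine Set.ncard_congr (fun p _ => (p.1 + p.2, p.1 - p.2)) ?_ ?_ ?_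
  · rintro ⟨c, d⟩ ⟨hc, hd, h⟩
    dsimp only at hc hd h
    refine ⟨?_, ?_, by dsimp only; linear_combination 2 * h⟩
    · simpa [two_mul] using hc.add hd
    · convert! hc.sub hd using 1; ring
  · rintro ⟨c, d⟩ ⟨c', d'⟩ - - h
    simp only [Prod.mk.injEq] at h ⊢
    omega
  · rintro ⟨a, b⟩ ⟨ha, hb, h⟩
    dsimp only at ha hb h
    have hpar : Even (a + b) := by
      have : Even (a ^ 2 + b ^ 2) := h ▸ even_two_mul n
      simpa [Int.even_add, Int.even_pow] using this
    obtain ⟨c, hc⟩ := hpar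
    obtain rfl : a = 2 * c - b := by omega
    refine ⟨(c, c - b), ⟨?_, ?_, ?_⟩, by ext <;> dsimp only <;> ring⟩
    · refine Int.modEq_iff_dvd.2 <| hcop.dvd_of_dvd_mul_left ?_
      convert! (ha.add hb).dvd using 1; ring
    · refine Int.modEq_iff_dvd.2 <| hcop.dvd_of_dvd_mul_left ?_
      convert! (ha.sub hb).dvd using 1; ring
    · dsimp only; linarith

theorem stmt10 (m : ℕ) (hm : 0 < m) (l : ℤ) (hl : l = 2 * m + 1) (i j : ℤ) :
    proj 2 0 (thetaL l (2 * i) * thetaL l (2 * j)) =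
      thetaL l (i + j) ^ 2 * thetaL l (i - j) ^ 2 := by
  have hodd : Odd l := ⟨m, hl⟩
  have hL : thetaL l (2 * i) * thetaL l (2 * j) =
      ((theta l (2 * i) * theta l (2 * j) : PowerSeries (ZMod 2)) : LaurentSeries (ZMod 2)) :=
    (PowerSeries.coe_mul _ _).symm
  have hR : thetaL l (i + j) ^ 2 * thetaL l (i - j) ^ 2 =
      ((PowerSeries.expand 2 two_ne_zero (theta l (i + j) * theta l (i - j)) :
        PowerSeries (ZMod 2)) : LaurentSeries (ZMod 2)) := by
    rw [← powerSeries_zmod_two_sq, mul_pow, PowerSeries.coe_mul, PowerSeries.coe_pow,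
      PowerSeries.coe_pow]
    rfl
  rw [hL, hR]
  ext n
  change (if n ≡ 0 [ZMOD 2] then _ else 0) = _
  rw [PowerSeries.coeff_coe, PowerSeries.coeff_coe]
  by_cases hn : n < 0
  · simp [hn]
  lift n to ℕ using not_lt.1 hn
  simp only [hn, if_false, Int.natAbs_natCast, PowerSeries.coeff_expand]
  have hdvd : ((n : ℤ) ≡ 0 [ZMOD 2]) ↔ 2 ∣ n := by
    rw [Int.modEq_zero_iff_dvd]; omega
  simp only [hdvd]
  split_ifs with h2
  · obtain ⟨k, rfl⟩ := h2
    rw [Nat.mul_div_cancel_left k two_pos, coeff_theta_mul_theta, coeff_theta_mul_theta,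
      ncard_sum_two_sq_two_mul hodd]
    push_cast
    rfl
  · rfl
end

section
/- For all integers i and j, the quintic theta relation [i]^4·[2j] + [j]^4·[2i] + [2i]·[2j] + [i+j]²·[i−j]² = 0 holds in ℤ/2[[x]]. -/
open scoped Classical

open PowerSeries in
/-- Over `ℤ/2`, squaring a power series is the substitution `x ↦ x²`. -/
theorem sq_eq_expand_two (f : PowerSeries (ZMod 2)) : f ^ 2 = expand 2 two_ne_zero f := by
  have h := MvPowerSeries.map_frobenius_expand (R := ZMod 2) 2 two_ne_zero (f := f)
  rw [ZMod.frobenius_zmod] at h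
  rw [← h]
  rfl

/-- The generating series over `ℤ/2` of a set `s` graded by a weight function `w`. -/
noncomputable def genSeries {α : Type*} (s : Set α) (w : α → ℕ) : PowerSeries (ZMod 2) :=
  PowerSeries.mk fun k => (({a | a ∈ s ∧ w a = k}.ncard : ℕ) : ZMod 2)

theorem genSeries_union {α : Type*} {s t : Set α} {w : α → ℕ} (hw : ∀ k, {a | w a = k}.Finite)
    (hst : Disjoint s t) : genSeries (s ∪ t) w = genSeries s w + genSeries t w := by
  ext k
  simp only [genSeries, PowerSeries.coeff_mk, map_add]
  rw [← Nat.cast_add, ← Set.ncard_union_eq (hst.mono (fun _ h => h.1) fun _ h => h.1)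
    ((hw k).subset fun _ h => h.2) ((hw k).subset fun _ h => h.2)]
  congr 2
  ext a
  simp [or_and_right]

theorem genSeries_image {α β : Type*} {f : α → β} (hf : f.Injective) (s : Set α) (w : β → ℕ) :
    genSeries (f '' s) w = genSeries s (w ∘ f) := by
  ext k
  simp only [genSeries, PowerSeries.coeff_mk]
  rw [← Set.ncard_image_of_injective _ hf]
  congr 2
  ext b
  simp only [Set.mem_image, Set.mem_ofPred_eq, Function.comp_apply]
  constructor
  · rintro ⟨⟨a, ha, rfl⟩, hb⟩
    exact ⟨a, ⟨ha, hb⟩, rfl⟩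
  · rintro ⟨a, ⟨ha, hb⟩, rfl⟩
    exact ⟨⟨a, ha, rfl⟩, hb⟩

theorem genSeries_mul {α β : Type*} {v : α → ℕ} {w : β → ℕ} (hv : ∀ k, {a | v a = k}.Finite)
    (hw : ∀ k, {b | w b = k}.Finite) (s : Set α) (t : Set β) :
    genSeries s v * genSeries t w = genSeries (s ×ˢ t) fun p => v p.1 + w p.2 := by
  ext k
  have hs (m : ℕ) : {a | a ∈ s ∧ v a = m}.Finite := (hv m).subset fun _ h => h.2
  have ht (m : ℕ) : {b | b ∈ t ∧ w b = m}.Finite := (hw m).subset fun _ h => h.2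
  have hU : {p : α × β | p ∈ s ×ˢ t ∧ v p.1 + w p.2 = k} =
      ((Finset.HasAntidiagonal.antidiagonal k).biUnion fun c => (hs c.1).toFinset ×ˢ (ht c.2).toFinset :
        Finset (α × β)) := by
    ext p
    simp only [Set.mem_prod, Set.mem_ofPred_eq, Finset.coe_biUnion, Set.mem_iUnion, Finset.mem_coe,
      Finset.HasAntidiagonal.mem_antidiagonal, Finset.mem_product, Set.Finite.mem_toFinset,
      Prod.exists]
    constructor
    · rintro ⟨⟨h1, h2⟩, h⟩
      exact ⟨_, _, h, ⟨h1, rfl⟩, h2, rfl⟩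
    · rintro ⟨_, _, h, ⟨h1, rfl⟩, h2, rfl⟩
      exact ⟨⟨h1, h2⟩, h⟩
  simp only [genSeries, PowerSeries.coeff_mul, PowerSeries.coeff_mk]
  rw [hU, Set.ncard_coe_finset, Finset.card_biUnion]
  · push_cast
    refine Finset.sum_congr rfl fun c _ => ?_
    rw [Finset.card_product, Set.ncard_eq_toFinset_card _ (hs _),
      Set.ncard_eq_toFinset_card _ (ht _), Nat.cast_mul]
  · intro c _ d _ hcd
    refine Finset.disjoint_left.2 fun p hc hd => hcd ?_
    simp only [Finset.mem_product, Set.Finite.mem_toFinset, Set.mem_ofPred_eq] at hc hd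
    exact Prod.ext (hc.1.2.symm.trans hd.1.2) (hc.2.2.symm.trans hd.2.2)

theorem genSeries_sq {α : Type*} (s : Set α) (w : α → ℕ) :
    genSeries s w ^ 2 = genSeries s fun a => 2 * w a := by
  rw [sq_eq_expand_two]
  ext k
  rw [PowerSeries.coeff_expand]
  split_ifs with h
  · obtain ⟨q, rfl⟩ := h
    simp [genSeries]
  · simp only [genSeries, PowerSeries.coeff_mk]
    have : {a | a ∈ s ∧ 2 * w a = k} = ∅ :=
      Set.eq_empty_of_forall_notMem fun a ha => h ⟨w a, ha.2.symm⟩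
    simp [this]

theorem finite_natAbs_sq_eq (k : ℕ) : {n : ℤ | n.natAbs ^ 2 = k}.Finite := by
  refine (Set.finite_Icc (-(k : ℤ)) k).subset fun n hn => ?_
  have h : n.natAbs ≤ k := (Nat.le_self_pow two_ne_zero _).trans_eq hn
  exact ⟨by omega, by omega⟩

theorem finite_natAbs_sq_add_natAbs_sq_eq (k : ℕ) :
    {p : ℤ × ℤ | p.1.natAbs ^ 2 + p.2.natAbs ^ 2 = k}.Finite := by
  refine ((Set.finite_Icc (-(k : ℤ)) k).prod (Set.finite_Icc (-(k : ℤ)) k)).subset fun p hp => ?_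
  have hp : p.1.natAbs ^ 2 + p.2.natAbs ^ 2 = k := hp
  have h1 := Nat.le_self_pow two_ne_zero p.1.natAbs
  have h2 := Nat.le_self_pow two_ne_zero p.2.natAbs
  exact ⟨⟨by omega, by omega⟩, by omega, by omega⟩

theorem theta_eq_genSeries (l i : ℤ) :
    theta l i = genSeries {n | n ≡ i [ZMOD l]} fun n => n.natAbs ^ 2 := by
  ext k
  simp only [theta, genSeries, PowerSeries.coeff_mk, Set.mem_ofPred_eq]
  congr 3
  ext n
  rw [← Int.natAbs_sq n]
  norm_cast

/-- The part of `theta l i` coming from the even integers. -/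
noncomputable def thetaEven (l i : ℤ) : PowerSeries (ZMod 2) :=
  genSeries {n | n ≡ i [ZMOD l] ∧ Even n} fun n => n.natAbs ^ 2

/-- The part of `theta l i` coming from the odd integers. -/
noncomputable def thetaOdd (l i : ℤ) : PowerSeries (ZMod 2) :=
  genSeries {n | n ≡ i [ZMOD l] ∧ Odd n} fun n => n.natAbs ^ 2

theorem theta_eq_thetaEven_add_thetaOdd (l i : ℤ) :
    theta l i = thetaEven l i + thetaOdd l i := by
  rw [theta_eq_genSeries, thetaEven, thetaOdd, ← genSeries_union finite_natAbs_sq_eq]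
  · congr 1
    ext n
    have := Int.even_or_odd n
    simp only [Set.mem_ofPred_eq, Set.mem_union]
    tauto
  · exact Set.disjoint_left.2 fun n h h' => Int.not_even_iff_odd.2 h'.2 h.2

theorem two_mul_modEq_two_mul_iff {l : ℤ} (hl : Odd l) {a b : ℤ} :
    2 * a ≡ 2 * b [ZMOD l] ↔ a ≡ b [ZMOD l] := by
  refine ⟨fun h => ?_, fun h => h.mul_left 2⟩
  rw [Int.modEq_iff_dvd] at h ⊢
  rw [← mul_sub] at h
  exact (Int.isCoprime_two_right.2 hl).dvd_of_dvd_mul_left h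

theorem theta_pow_four {l : ℤ} (hl : Odd l) (i : ℤ) :
    theta l i ^ 4 = thetaEven l (2 * i) := by
  have hinj : Function.Injective fun n : ℤ => 2 * n := fun a b h => by
    simpa using h
  have himg : {n | n ≡ 2 * i [ZMOD l] ∧ Even n} =
      (fun n : ℤ => 2 * n) '' {n | n ≡ i [ZMOD l]} := by
    ext n
    constructor
    · rintro ⟨h, hn⟩
      obtain ⟨r, rfl⟩ := hn.two_dvd
      exact ⟨r, (two_mul_modEq_two_mul_iff hl).1 h, rfl⟩
    · rintro ⟨r, h, rfl⟩
      exact ⟨(two_mul_modEq_two_mul_iff hl).2 h, even_two_mul r⟩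
  rw [thetaEven, himg, genSeries_image hinj, theta_eq_genSeries, show 4 = 2 * 2 from rfl, pow_mul,
    genSeries_sq, genSeries_sq]
  congr 1
  ext n
  simp only [Function.comp_apply, Int.natAbs_mul]
  norm_num
  ring

theorem thetaEven_mul_add_thetaOdd_mul {l : ℤ} (hl : Odd l) (i j : ℤ) :
    thetaEven l (2 * i) * thetaEven l (2 * j) + thetaOdd l (2 * i) * thetaOdd l (2 * j) =
      theta l (i + j) ^ 2 * theta l (i - j) ^ 2 := by
  let f : ℤ × ℤ → ℤ × ℤ := fun p => (p.1 + p.2, p.1 - p.2)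
  have hinj : f.Injective := fun a b h => by
    have h1 : a.1 + a.2 = b.1 + b.2 := congrArg Prod.fst h
    have h2 : a.1 - a.2 = b.1 - b.2 := congrArg Prod.snd h
    exact Prod.ext (by omega) (by omega)
  have himg : {n | n ≡ 2 * i [ZMOD l] ∧ Even n} ×ˢ {n | n ≡ 2 * j [ZMOD l] ∧ Even n} ∪
      {n | n ≡ 2 * i [ZMOD l] ∧ Odd n} ×ˢ {n | n ≡ 2 * j [ZMOD l] ∧ Odd n} =
      f '' ({n | n ≡ i + j [ZMOD l]} ×ˢ {n | n ≡ i - j [ZMOD l]}) := by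
    ext ⟨a, b⟩
    constructor
    · intro h
      have hab : a ≡ 2 * i [ZMOD l] ∧ b ≡ 2 * j [ZMOD l] ∧ Even (a + b) := by
        rcases h with ⟨⟨ha, ha'⟩, hb, hb'⟩ | ⟨⟨ha, ha'⟩, hb, hb'⟩
        · exact ⟨ha, hb, ha'.add hb'⟩
        · exact ⟨ha, hb, ha'.add_odd hb'⟩
      obtain ⟨ha, hb, r, hr⟩ := hab
      refine ⟨(r, r - b), ⟨?_, ?_⟩, Prod.ext ?_ ?_⟩
      · refine (two_mul_modEq_two_mul_iff hl).1 ?_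
        convert ha.add hb using 1 <;> linarith
      · refine (two_mul_modEq_two_mul_iff hl).1 ?_
        convert ha.sub hb using 1 <;> linarith
      · change r + (r - b) = a
        linarith
      · change r - (r - b) = b
        linarith
    · rintro ⟨⟨u, v⟩, ⟨hu, hv⟩, h⟩
      have hu : u ≡ i + j [ZMOD l] := hu
      have hv : v ≡ i - j [ZMOD l] := hv
      obtain ⟨rfl, rfl⟩ := Prod.mk.inj h
      have ha : u + v ≡ 2 * i [ZMOD l] := by
        convert hu.add hv using 1
        ring
      have hb : u - v ≡ 2 * j [ZMOD l] := by
        convert hu.sub hv using 1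
        ring
      rcases Int.even_or_odd (u + v) with he | ho
      · exact Or.inl ⟨⟨ha, he⟩, hb, by rwa [Int.even_sub, ← Int.even_add]⟩
      · refine Or.inr ⟨⟨ha, ho⟩, hb, ?_⟩
        rw [← Int.not_even_iff_odd] at ho ⊢
        rwa [Int.even_sub, ← Int.even_add]
  simp only [thetaEven, thetaOdd]
  rw [genSeries_mul finite_natAbs_sq_eq finite_natAbs_sq_eq,
    genSeries_mul finite_natAbs_sq_eq finite_natAbs_sq_eq,
    ← genSeries_union finite_natAbs_sq_add_natAbs_sq_eq, himg, genSeries_image hinj, ← mul_pow,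
    theta_eq_genSeries, theta_eq_genSeries, genSeries_mul finite_natAbs_sq_eq finite_natAbs_sq_eq,
    genSeries_sq]
  · congr 1
    ext p
    zify
    simp only [f, Function.comp_apply, sq_abs]
    push_cast
    simp only [sq_abs]
    ring
  · exact Set.disjoint_left.2 fun p h h' => Int.not_even_iff_odd.2 h'.1.2 h.1.2

theorem stmt11 (m : ℕ) (hm : 0 < m) (l : ℤ) (hl : l = 2 * m + 1) (i j : ℤ) :
    theta l i ^ 4 * theta l (2 * j) + theta l j ^ 4 * theta l (2 * i) +
        theta l (2 * i) * theta l (2 * j) + theta l (i + j) ^ 2 * theta l (i - j) ^ 2 = 0 := by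
  have hodd : Odd l := ⟨m, hl⟩
  have h2 : (2 : PowerSeries (ZMod 2)) = 0 := by
    simpa only [map_ofNat, map_zero] using
      congrArg PowerSeries.C (CharTwo.two_eq_zero (R := ZMod 2))
  rw [theta_pow_four hodd, theta_pow_four hodd, ← thetaEven_mul_add_thetaOdd_mul hodd,
    theta_eq_thetaEven_add_thetaOdd l (2 * i), theta_eq_thetaEven_add_thetaOdd l (2 * j)]
  linear_combination (2 * thetaEven l (2 * i) * thetaEven l (2 * j) +
    thetaEven l (2 * i) * thetaOdd l (2 * j) + thetaOdd l (2 * i) * thetaEven l (2 * j) +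
    thetaOdd l (2 * i) * thetaOdd l (2 * j)) * h2
end

section
/- Suppose a, b ∈ L with a ≠ 0 and p_{2,0}(a) = b^4. Then: (1) p_{2,0}(1/a) = b^4/a²; (2) p_{4,0}(1/a) = b^12/a^4; (3) p_{8,0}(1/a) = (b^8/a^8)·(p_{2,0}(ab))^4. -/
open scoped Classical

theorem coeff_proj_zero (q : ℤ) (f : LaurentSeries (ZMod 2)) (n : ℤ) :
    (proj q 0 f).coeff n = if q ∣ n then f.coeff n else 0 := by
  simp only [proj, Int.modEq_zero_iff_dvd]

theorem coeff_sq_eq_sum_diag (f : LaurentSeries (ZMod 2)) (n : ℤ) :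
    (f ^ 2).coeff n =
      ∑ ij ∈ (Finset.antidiagonal f.isPWO_support f.isPWO_support n).filter
        (fun ij => ij.1 = ij.2), f.coeff ij.1 * f.coeff ij.2 := by
  rw [sq, HahnSeries.coeff_mul, ← Finset.sum_filter_add_sum_filter_not _ (fun ij => ij.1 = ij.2),
    add_eq_left]
  refine Finset.sum_involution (fun ij _ => ij.swap) ?_ ?_ ?_ ?_
  · intro ij _
    simp only [Prod.fst_swap, Prod.snd_swap]
    rw [mul_comm (f.coeff ij.2)]
    exact CharTwo.add_self_eq_zero _
  · rintro ⟨i, j⟩ hij _ h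
    simp only [Finset.mem_filter] at hij
    simp only [Prod.swap_prod_mk, Prod.mk.injEq] at h
    exact hij.2 h.2
  · rintro ⟨i, j⟩ hij
    simp only [Finset.mem_filter, Finset.mem_antidiagonal, Prod.swap_prod_mk] at hij ⊢
    exact ⟨⟨hij.1.2.1, hij.1.1, by rw [add_comm]; exact hij.1.2.2⟩, fun h => hij.2 h.symm⟩
  · intro ij _
    exact Prod.swap_swap ij

theorem coeff_sq_two_mul (f : LaurentSeries (ZMod 2)) (n : ℤ) :
    (f ^ 2).coeff (2 * n) = f.coeff n := by
  rw [coeff_sq_eq_sum_diag, Finset.sum_eq_single (n, n)]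
  · generalize f.coeff n = c
    revert c
    decide
  · rintro ⟨i, j⟩ hij hne
    simp only [Finset.mem_filter, Finset.mem_antidiagonal] at hij
    exact absurd (Prod.ext (by dsimp only; lia) (by dsimp only; lia)) hne
  · intro h
    have : f.coeff n = 0 := by
      by_contra hn
      exact h (by simp [Finset.mem_antidiagonal, hn, two_mul])
    simp [this]

theorem coeff_sq_two_mul_add_one (f : LaurentSeries (ZMod 2)) (n : ℤ) :
    (f ^ 2).coeff (2 * n + 1) = 0 := by
  rw [coeff_sq_eq_sum_diag]
  refine Finset.sum_eq_zero fun ij hij => ?_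
  simp only [Finset.mem_filter, Finset.mem_antidiagonal] at hij
  lia

theorem proj_sq (q : ℤ) (f : LaurentSeries (ZMod 2)) :
    proj (2 * q) 0 (f ^ 2) = proj q 0 f ^ 2 := by
  ext n
  obtain ⟨m, rfl | rfl⟩ := Int.even_or_odd' n
  · simp only [coeff_proj_zero, coeff_sq_two_mul,
      mul_dvd_mul_iff_left (two_ne_zero : (2 : ℤ) ≠ 0)]
  · simp only [coeff_proj_zero, coeff_sq_two_mul_add_one, ite_self]

theorem proj_one_zero (f : LaurentSeries (ZMod 2)) : proj 1 0 f = f := by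
  ext n
  simp [coeff_proj_zero]

theorem proj_two_pow (k : ℕ) (q : ℤ) (f : LaurentSeries (ZMod 2)) :
    proj (2 ^ k * q) 0 (f ^ 2 ^ k) = proj q 0 f ^ 2 ^ k := by
  induction k with
  | zero => simp
  | succ k ih =>
    rw [pow_succ' (2 : ℤ), pow_succ (2 : ℕ), pow_mul, pow_mul, mul_assoc, proj_sq, ih]

theorem proj_two_pow_self (k : ℕ) (f : LaurentSeries (ZMod 2)) :
    proj (2 ^ k) 0 (f ^ 2 ^ k) = f ^ 2 ^ k := by
  simpa [proj_one_zero] using proj_two_pow k 1 f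

theorem proj_proj_of_dvd {q r : ℤ} (h : q ∣ r) (f : LaurentSeries (ZMod 2)) :
    proj r 0 (proj q 0 f) = proj r 0 f := by
  ext n
  simp only [coeff_proj_zero]
  split_ifs with h₁ h₂
  · rfl
  · exact absurd (h.trans h₁) h₂
  · rfl

theorem proj_mul_of_proj_eq_self {q : ℤ} {f : LaurentSeries (ZMod 2)} (hf : proj q 0 f = f)
    (g : LaurentSeries (ZMod 2)) : proj q 0 (f * g) = f * proj q 0 g := by
  have hdvd {i : ℤ} (hi : f.coeff i ≠ 0) : q ∣ i := by
    by_contra h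
    rw [← hf, coeff_proj_zero, if_neg h] at hi
    exact hi rfl
  have hsupp : (proj q 0 g).support ⊆ g.support := fun n hn => by
    simp only [HahnSeries.mem_support, coeff_proj_zero, ne_eq] at hn ⊢
    exact fun h => hn (by simp [h])
  ext n
  rw [coeff_proj_zero, HahnSeries.coeff_mul, HahnSeries.coeff_mul_right' g.isPWO_support hsupp]
  split_ifs with hn
  · refine Finset.sum_congr rfl fun ij hij => ?_
    simp only [Finset.mem_antidiagonal, HahnSeries.mem_support] at hij
    rw [coeff_proj_zero,
      if_pos ((Int.dvd_add_right (hdvd hij.1)).1 (hij.2.2 ▸ hn))]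
  · refine (Finset.sum_eq_zero fun ij hij => ?_).symm
    simp only [Finset.mem_antidiagonal, HahnSeries.mem_support] at hij
    rw [coeff_proj_zero,
      if_neg fun h => hn (hij.2.2 ▸ dvd_add (hdvd hij.1) h), mul_zero]

theorem stmt14 (a b : LaurentSeries (ZMod 2)) (ha : a ≠ 0) (hab : proj 2 0 a = b ^ 4) :
    proj 2 0 a⁻¹ = b ^ 4 / a ^ 2 ∧ proj 4 0 a⁻¹ = b ^ 12 / a ^ 4 ∧
      proj 8 0 a⁻¹ = b ^ 8 / a ^ 8 * (proj 2 0 (a * b)) ^ 4 := by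
  have h₂ : proj 2 0 a⁻¹ = b ^ 4 / a ^ 2 := by
    have h := proj_mul_of_proj_eq_self (proj_two_pow_self 1 a⁻¹) a
    norm_num at h
    rw [hab] at h
    rw [show a⁻¹ = (a ^ 2)⁻¹ * a by field_simp, h]
    field_simp
  have h₄ : proj 4 0 a⁻¹ = b ^ 12 / a ^ 4 := by
    have h := proj_mul_of_proj_eq_self (proj_two_pow_self 2 b) (a⁻¹ ^ 2)
    have hs := proj_sq 2 a⁻¹
    norm_num only at h hs
    rw [← proj_proj_of_dvd (show (2 : ℤ) ∣ 4 by norm_num), h₂, div_eq_mul_inv, ← inv_pow, h, hs,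
      h₂]
    field_simp
  refine ⟨h₂, h₄, ?_⟩
  have h := proj_mul_of_proj_eq_self (proj_two_pow_self 3 (b / a)) ((a * b) ^ 4)
  have hp := proj_two_pow 2 2 (a * b)
  norm_num only at h hp
  rw [← proj_proj_of_dvd (show (4 : ℤ) ∣ 8 by norm_num), h₄,
    show b ^ 12 / a ^ 4 = (b / a) ^ 8 * (a * b) ^ 4 by field_simp, h, hp, div_pow]
end
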